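/- arXiv:2003.12335 — 2 statements merged into one kernel-verified Lean document; each statement's English description precedes it below -/
import Mathlib

section
/- Let Ω ⊆ ℂ be any domain. If Y₁ ⊊ ℂ and Y₂ ⊊ ℂ are conformally equivalent domains (i.e. there exists a holomorphic bijection from Y₁ onto Y₂), then η_Ω^{Y₁}(w) = η_Ω^{Y₂}(w) for all w ∈ Ω. -/
open Complex Set Metric
open scoped ENNReal

noncomputable section

/-- The open unit disk in the complex plane. -/
def unitDisk : Set ℂ := Metric.ball (0 : ℂ) 1

/-- A plane domain: a nonempty open connected subset of ℂ. -/
def IsPlaneDomain (S : Set ℂ) : Prop := IsOpen S ∧ IsConnected S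

/-- The Hurwitz radius `r_Ω(w)`: the supremum of `h'(0)` over all holomorphic
`h : 𝔻 → Ω` with `h 0 = w`, `h t ≠ w` for `t ∈ 𝔻 \ {0}`, and `h'(0) > 0` (real). -/
def hurwitzRadius (Ω : Set ℂ) (w : ℂ) : ℝ :=
  sSup { r : ℝ | 0 < r ∧ ∃ h : ℂ → ℂ, DifferentiableOn ℂ h unitDisk ∧
    Set.MapsTo h unitDisk Ω ∧ h 0 = w ∧ (∀ t ∈ unitDisk, t ≠ 0 → h t ≠ w) ∧
    deriv h 0 = (r : ℂ) }

/-- The Hurwitz density `η_Ω(w) = 2 / r_Ω(w)`. -/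
def hurwitzDensity (Ω : Set ℂ) (w : ℂ) : ℝ := 2 / hurwitzRadius Ω w

/-- A (C¹, hence rectifiable) path in `Ω` from `w₁` to `w₂`, parametrized on `[0,1]`. -/
def IsPathIn (Ω : Set ℂ) (w₁ w₂ : ℂ) (γ : ℝ → ℂ) : Prop :=
  γ 0 = w₁ ∧ γ 1 = w₂ ∧ (∀ t ∈ Set.Icc (0:ℝ) 1, γ t ∈ Ω) ∧
    ContDiffOn ℝ 1 γ (Set.Icc (0:ℝ) 1)

/-- The Hurwitz distance: infimum of Hurwitz lengths of rectifiable paths in `Ω`. -/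
def hurwitzDist (Ω : Set ℂ) (w₁ w₂ : ℂ) : ℝ :=
  sInf { L : ℝ | ∃ γ : ℝ → ℂ, IsPathIn Ω w₁ w₂ γ ∧
    L = ∫ t in (0:ℝ)..1, hurwitzDensity Ω (γ t) * ‖derivWithin γ (Set.Icc (0:ℝ) 1) t‖ }

/-- The generalized Hurwitz density `η_Ω^Y(w)` with basepoint domain `Y`
(`+∞` if no admissible map exists). -/
def genHurwitzDensity (Y Ω : Set ℂ) (w : ℂ) : ℝ≥0∞ :=
  sInf { x : ℝ≥0∞ | ∃ s ∈ Y, ∃ h : ℂ → ℂ, DifferentiableOn ℂ h Y ∧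
    Set.MapsTo h Y Ω ∧ h s = w ∧ (∀ t ∈ Y, t ≠ s → h t ≠ w) ∧ deriv h s ≠ 0 ∧
    x = ENNReal.ofReal (hurwitzDensity Y s / ‖deriv h s‖) }

/-- The generalized Hurwitz distance `η_Ω^Y(z₁,z₂)`. -/
def genHurwitzDist (Y Ω : Set ℂ) (z₁ z₂ : ℂ) : ℝ≥0∞ :=
  sInf { L : ℝ≥0∞ | ∃ γ : ℝ → ℂ, IsPathIn Ω z₁ z₂ γ ∧
    L = ∫⁻ t in Set.Icc (0:ℝ) 1,
      genHurwitzDensity Y Ω (γ t) * ENNReal.ofReal ‖derivWithin γ (Set.Icc (0:ℝ) 1) t‖ }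

/-- The infinitesimal contraction constant `l_η(Ω, Y)`. -/
def lEta (Ω Y : Set ℂ) : ℝ :=
  sSup { x : ℝ | ∃ w ∈ Ω, x = hurwitzDensity Y w / hurwitzDensity Ω w }

/-- The global contraction constant `gl_η(Ω, Y)`. -/
def glEta (Ω Y : Set ℂ) : ℝ :=
  sSup { x : ℝ | ∃ w₁ ∈ Ω, ∃ w₂ ∈ Ω, w₁ ≠ w₂ ∧
    x = hurwitzDist Y w₁ w₂ / hurwitzDist Ω w₁ w₂ }

open Filter Topology in
/-- An injective holomorphic function on an open set is an open map at every point. -/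
theorem nhds_le_map_nhds_of_injOn {U : Set ℂ} {f : ℂ → ℂ} (hU : IsOpen U)
    (hf : DifferentiableOn ℂ f U) (hinj : InjOn f U) {z : ℂ} (hz : z ∈ U) :
    𝓝 (f z) ≤ map f (𝓝 z) := by
  refine ((hf.analyticAt (hU.mem_nhds hz)).eventually_constant_or_nhds_le_map_nhds).resolve_left ?_
  intro hc
  have h : ∀ᶠ w in 𝓝[≠] z, False := by
    filter_upwards [hc.filter_mono nhdsWithin_le_nhds,
      (hU.eventually_mem hz).filter_mono nhdsWithin_le_nhds,
      self_mem_nhdsWithin] with w hw hwU hne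
    exact hne (hinj hwU hz hw)
  exact h.exists.elim fun _ h => h

open Filter Topology in
/-- The derivative of an injective holomorphic function has isolated zeros. -/
theorem eventually_deriv_ne_zero_of_injOn {U : Set ℂ} {f : ℂ → ℂ} (hU : IsOpen U)
    (hf : DifferentiableOn ℂ f U) (hinj : InjOn f U) {z : ℂ} (hz : z ∈ U) :
    ∀ᶠ w in 𝓝[≠] z, deriv f w ≠ 0 := by
  refine (hf.analyticAt (hU.mem_nhds hz)).deriv.eventually_eq_zero_or_eventually_ne_zero.resolve_left
    fun h0 => ?_
  obtain ⟨ε, hε, hball⟩ := Metric.eventually_nhds_iff_ball.1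
    (h0.and (hU.eventually_mem hz))
  have hconst : ∀ w ∈ ball z ε, f w = f z := fun w hw =>
    isOpen_ball.is_const_of_deriv_eq_zero (convex_ball z ε).isPreconnected
      (hf.mono fun x hx => (hball x hx).2) (fun x hx => (hball x hx).1) hw (mem_ball_self hε)
  have h : ∀ᶠ w in 𝓝[≠] z, False := by
    filter_upwards [mem_nhdsWithin_of_mem_nhds (ball_mem_nhds z hε), self_mem_nhdsWithin]
      with w hw hne
    exact hne (hinj (hball w hw).2 hz (hconst w hw))
  exact h.exists.elim fun _ h => h

open Filter Topology in
/-- The inverse of a holomorphic bijection between open sets is holomorphic. -/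
theorem differentiableOn_of_invOn {U V : Set ℂ} {f g : ℂ → ℂ} (hU : IsOpen U) (hV : IsOpen V)
    (hf : DifferentiableOn ℂ f U) (hgm : MapsTo g V U) (hinv : InvOn g f U V) :
    DifferentiableOn ℂ g V := by
  have hinj : InjOn f U := hinv.1.injOn
  have hcont : ∀ v ∈ V, ContinuousAt g v := by
    intro v hv
    have hle := nhds_le_map_nhds_of_injOn hU hf hinj (hgm hv)
    rw [hinv.2 hv] at hle
    refine Tendsto.mono_left (tendsto_map'_iff.2 ?_) hle
    refine Tendsto.congr' ?_ tendsto_id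
    filter_upwards [hU.mem_nhds (hgm hv)] with x hx
    exact (hinv.1 hx).symm
  have hdiff : ∀ v ∈ V, deriv f (g v) ≠ 0 → DifferentiableAt ℂ g v := by
    intro v hv h
    refine (HasDerivAt.of_local_left_inverse (hcont v hv)
      (hf.differentiableAt (hU.mem_nhds (hgm hv))).hasDerivAt h ?_).differentiableAt
    filter_upwards [hV.mem_nhds hv] with x hx
    exact hinv.2 hx
  intro v hv
  refine (analyticAt_of_differentiable_on_punctured_nhds_of_continuousAt ?_
    (hcont v hv)).differentiableAt.differentiableWithinAt
  have hVev : ∀ᶠ x in 𝓝[≠] v, x ∈ V := mem_nhdsWithin_of_mem_nhds (hV.mem_nhds hv)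
  have htend : Tendsto g (𝓝[≠] v) (𝓝[≠] (g v)) := by
    refine tendsto_nhdsWithin_iff.2 ⟨(hcont v hv).mono_left nhdsWithin_le_nhds, ?_⟩
    filter_upwards [hVev, self_mem_nhdsWithin] with x hx hne heq
    exact hne (hinv.2.injOn hx hv heq)
  filter_upwards [hVev, htend.eventually (eventually_deriv_ne_zero_of_injOn hU hf hinj (hgm hv))]
    with x hx h
  exact hdiff x hx h

/-- The derivatives of mutually inverse holomorphic functions are inverse to each other. -/
theorem deriv_mul_deriv_of_leftInvOn {U V : Set ℂ} {f g : ℂ → ℂ} (hU : IsOpen U) (hV : IsOpen V)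
    (hf : DifferentiableOn ℂ f U) (hg : DifferentiableOn ℂ g V) (hfm : MapsTo f U V)
    (hinv : LeftInvOn g f U) {z : ℂ} (hz : z ∈ U) :
    deriv g (f z) * deriv f z = 1 := by
  have h1 := ((hg.differentiableAt (hV.mem_nhds (hfm hz))).hasDerivAt.comp z
    (hf.differentiableAt (hU.mem_nhds hz)).hasDerivAt)
  have h2 : HasDerivAt (g ∘ f) 1 z := by
    refine (hasDerivAt_id z).congr_of_eventuallyEq ?_
    filter_upwards [hU.mem_nhds hz] with x hx
    exact hinv hx
  exact h1.unique h2

/-- The set of derivatives at the origin whose supremum is `hurwitzRadius Ω w`. -/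
def hurwitzRadii (Ω : Set ℂ) (w : ℂ) : Set ℝ :=
  { r : ℝ | 0 < r ∧ ∃ h : ℂ → ℂ, DifferentiableOn ℂ h unitDisk ∧
    Set.MapsTo h unitDisk Ω ∧ h 0 = w ∧ (∀ t ∈ unitDisk, t ≠ 0 → h t ≠ w) ∧
    deriv h 0 = (r : ℂ) }

/-- Postcomposition with an injective holomorphic map, after a rotation of the disk, multiplies
the elements of `hurwitzRadii` by the modulus of the derivative. -/
theorem norm_deriv_mul_mem_hurwitzRadii {U V : Set ℂ} {f : ℂ → ℂ} (hU : IsOpen U)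
    (hf : DifferentiableOn ℂ f U) (hfm : MapsTo f U V) (hinj : InjOn f U) {z : ℂ} (hz : z ∈ U)
    (hd : deriv f z ≠ 0) {r : ℝ} (hr : r ∈ hurwitzRadii U z) :
    ‖deriv f z‖ * r ∈ hurwitzRadii V (f z) := by
  obtain ⟨hr0, h, hh, hm, h0, hne, hder⟩ := hr
  have hnpos : 0 < ‖deriv f z‖ := norm_pos_iff.2 hd
  set u : ℂ := (‖deriv f z‖ : ℂ) / deriv f z with hu
  have hnC : (‖deriv f z‖ : ℂ) ≠ 0 := by exact_mod_cast hnpos.ne'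
  have hu0 : u ≠ 0 := div_ne_zero hnC hd
  have hun : ‖u‖ = 1 := by
    rw [hu, norm_div, Complex.norm_real, norm_norm, div_self hnpos.ne']
  have hrot : MapsTo (fun t => u * t) unitDisk unitDisk := by
    intro t ht
    simpa [unitDisk, hun] using ht
  have hdisk : IsOpen unitDisk := isOpen_ball
  have h0mem : (0 : ℂ) ∈ unitDisk := mem_ball_self one_pos
  refine ⟨mul_pos hnpos hr0, fun t => f (h (u * t)), ?_, ?_, ?_, ?_, ?_⟩
  · exact hf.comp (hh.comp (by fun_prop) hrot) (hm.comp hrot)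
  · exact fun t ht => hfm (hm (hrot ht))
  · simp [h0]
  · intro t ht ht0 heq
    exact hne _ (hrot ht) (mul_ne_zero hu0 ht0) (hinj (hm (hrot ht)) hz heq)
  · have h1 : HasDerivAt (fun t : ℂ => u * t) u 0 := by
      simpa using (hasDerivAt_id (0 : ℂ)).const_mul u
    have h2 : HasDerivAt h (r : ℂ) (u * 0) := by
      rw [mul_zero, ← hder]
      exact (hh.differentiableAt (hdisk.mem_nhds h0mem)).hasDerivAt
    have h3 : HasDerivAt f (deriv f z) (h (u * 0)) := by
      rw [mul_zero, h0]
      exact (hf.differentiableAt (hU.mem_nhds hz)).hasDerivAt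
    have h4 := HasDerivAt.comp (0 : ℂ) h3 (HasDerivAt.comp (0 : ℂ) h2 h1)
    refine h4.deriv.trans ?_
    rw [hu]
    push_cast
    field_simp

open scoped Pointwise in
/-- Conformal invariance of the Hurwitz radius. -/
theorem hurwitzRadius_map {U V : Set ℂ} {f g : ℂ → ℂ} (hU : IsOpen U) (hV : IsOpen V)
    (hf : DifferentiableOn ℂ f U) (hg : DifferentiableOn ℂ g V) (hfm : MapsTo f U V)
    (hgm : MapsTo g V U) (hinv : InvOn g f U V) {z : ℂ} (hz : z ∈ U) :
    hurwitzRadius V (f z) = ‖deriv f z‖ * hurwitzRadius U z := by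
  have hmul := deriv_mul_deriv_of_leftInvOn hU hV hf hg hfm hinv.1 hz
  have hdf : deriv f z ≠ 0 := right_ne_zero_of_mul_eq_one hmul
  have hdg : deriv g (f z) ≠ 0 := left_ne_zero_of_mul_eq_one hmul
  have hnmul : ‖deriv f z‖ * ‖deriv g (f z)‖ = 1 := by
    rw [mul_comm, ← norm_mul, hmul, norm_one]
  have hset : hurwitzRadii V (f z) = ‖deriv f z‖ • hurwitzRadii U z := by
    ext r
    constructor
    · intro hr
      have := norm_deriv_mul_mem_hurwitzRadii hV hg hgm hinv.2.injOn (hfm hz) hdg hr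
      rw [hinv.1 hz] at this
      refine ⟨_, this, ?_⟩
      simp only [smul_eq_mul]
      rw [← mul_assoc, hnmul, one_mul]
    · rintro ⟨s, hs, rfl⟩
      exact norm_deriv_mul_mem_hurwitzRadii hU hf hfm hinv.1.injOn hz hdf hs
  change sSup (hurwitzRadii V (f z)) = ‖deriv f z‖ * sSup (hurwitzRadii U z)
  rw [hset, Real.sSup_smul_of_nonneg (norm_nonneg _), smul_eq_mul]

/-- One inequality in the conformal invariance of the generalized Hurwitz density. -/
theorem genHurwitzDensity_le_of_invOn {U V : Set ℂ} {f g : ℂ → ℂ} (Ω : Set ℂ) (hU : IsOpen U)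
    (hV : IsOpen V) (hf : DifferentiableOn ℂ f U) (hg : DifferentiableOn ℂ g V)
    (hfm : MapsTo f U V) (hgm : MapsTo g V U) (hinv : InvOn g f U V) (w : ℂ) :
    genHurwitzDensity U Ω w ≤ genHurwitzDensity V Ω w := by
  refine le_sInf ?_
  rintro x ⟨s, hs, h, hh, hm, hsw, hne, hd, rfl⟩
  obtain ⟨z, hz, rfl⟩ : ∃ z ∈ U, f z = s := ⟨g s, hgm hs, hinv.2 hs⟩
  have hdf : deriv f z ≠ 0 := right_ne_zero_of_mul_eq_one
    (deriv_mul_deriv_of_leftInvOn hU hV hf hg hfm hinv.1 hz)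
  have hcomp : deriv (h ∘ f) z = deriv h (f z) * deriv f z :=
    deriv_comp z (hh.differentiableAt (hV.mem_nhds hs)) (hf.differentiableAt (hU.mem_nhds hz))
  refine sInf_le ⟨z, hz, h ∘ f, hh.comp hf hfm, hm.comp hfm, hsw, ?_, ?_, ?_⟩
  · exact fun t ht htz => hne _ (hfm ht) fun heq => htz (hinv.1.injOn ht hz heq)
  · rw [hcomp]
    exact mul_ne_zero hd hdf
  · congr 1
    rw [hcomp, hurwitzDensity, hurwitzDensity, hurwitzRadius_map hU hV hf hg hfm hgm hinv hz,
      norm_mul, div_div, div_div]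
    congr 1
    ring

/-- the generalized Hurwitz density is invariant under conformal
equivalence of the basepoint domain. -/
theorem genHurwitz_conformal_invariance_base
    (Ω Y₁ Y₂ : Set ℂ) (hΩ : IsPlaneDomain Ω)
    (hY₁ : IsPlaneDomain Y₁) (hY₁p : Y₁ ≠ Set.univ)
    (hY₂ : IsPlaneDomain Y₂) (hY₂p : Y₂ ≠ Set.univ)
    (hconf : ∃ f : ℂ → ℂ, DifferentiableOn ℂ f Y₁ ∧ Set.BijOn f Y₁ Y₂) :
    ∀ w ∈ Ω, genHurwitzDensity Y₁ Ω w = genHurwitzDensity Y₂ Ω w := by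
  obtain ⟨f, hf, hbij⟩ := hconf
  have hinv : InvOn (Function.invFunOn f Y₁) f Y₁ Y₂ := hbij.invOn_invFunOn
  have hgm : MapsTo (Function.invFunOn f Y₁) Y₂ Y₁ := hbij.surjOn.mapsTo_invFunOn
  have hg := differentiableOn_of_invOn hY₁.1 hY₂.1 hf hgm hinv
  intro w _
  exact le_antisymm
    (genHurwitzDensity_le_of_invOn Ω hY₁.1 hY₂.1 hf hg hbij.mapsTo hgm hinv w)
    (genHurwitzDensity_le_of_invOn Ω hY₂.1 hY₁.1 hg hf hgm hbij.mapsTo hinv.symm w)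
end
end

section
/- Let Y ⊊ ℂ be a domain and let Ω be a subdomain of Y. Then the global contraction constant is bounded by the infinitesimal one: gl_η(Ω,Y) ≤ l_η(Ω,Y) ≤ 1. Furthermore, if Ω is a proper subdomain of Y, then the inclusion map from Ω into Y is a strict infinitesimal contraction, i.e. η_Y(w) < η_Ω(w) for every w ∈ Ω. -/
open Complex Set Metric
open scoped ENNReal

noncomputable section

section

open Topology ComplexConjugate Filter

/-! ### Branches of the logarithm, the square root and the arc cosine on the disk -/

theorem exists_exp_eq {f : ℂ → ℂ} (hf : DifferentiableOn ℂ f (ball 0 1))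
    (h0 : ∀ z ∈ ball (0 : ℂ) 1, f z ≠ 0) {α : ℂ} (hα : exp α = f 0) :
    ∃ g : ℂ → ℂ, DifferentiableOn ℂ g (ball 0 1) ∧ g 0 = α ∧
      ∀ z ∈ ball (0 : ℂ) 1, exp (g z) = f z := by
  have hf' : DifferentiableOn ℂ (deriv f) (ball 0 1) := hf.deriv isOpen_ball
  obtain ⟨g, hg0, hg⟩ := ((hf'.div hf h0).isExactOn_ball).with_val_at 0 α
  refine ⟨g, fun z hz => (hg z hz).differentiableAt.differentiableWithinAt, hg0, ?_⟩
  have hder : ∀ z ∈ ball (0 : ℂ) 1, HasDerivAt (fun z => f z * exp (-g z)) 0 z := by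
    intro z hz
    have h1 := ((hf z hz).differentiableAt (isOpen_ball.mem_nhds hz)).hasDerivAt
    convert! h1.mul (hg z hz).neg.cexp using 1
    simp only [Pi.div_apply]
    field_simp [h0 z hz]
    ring
  have hconst : ∀ z ∈ ball (0 : ℂ) 1, f z * exp (-g z) = f 0 * exp (-g 0) := by
    intro z hz
    refine isOpen_ball.is_const_of_deriv_eq_zero (convex_ball (0 : ℂ) 1).isPreconnected
      (fun z hz => (hder z hz).differentiableAt.differentiableWithinAt)
      (fun z hz => (hder z hz).deriv) hz (by simp)
  intro z hz
  have h2 := hconst z hz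
  rw [hg0, ← hα, ← Complex.exp_add, add_neg_cancel, Complex.exp_zero, Complex.exp_neg] at h2
  field_simp [Complex.exp_ne_zero] at h2
  exact h2.symm

theorem exists_sq_eq {f : ℂ → ℂ} (hf : DifferentiableOn ℂ f (ball 0 1))
    (h0 : ∀ z ∈ ball (0 : ℂ) 1, f z ≠ 0) {a : ℂ} (ha : a ^ 2 = f 0) :
    ∃ g : ℂ → ℂ, DifferentiableOn ℂ g (ball 0 1) ∧ g 0 = a ∧
      ∀ z ∈ ball (0 : ℂ) 1, g z ^ 2 = f z := by
  have ha0 : a ≠ 0 := by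
    rintro rfl
    exact h0 0 (by simp) (by rw [← ha]; simp)
  obtain ⟨g, hg, hg0, hge⟩ := exists_exp_eq hf h0 (α := 2 * log a)
    (by rw [two_mul, Complex.exp_add, Complex.exp_log ha0, ← ha, sq])
  refine ⟨fun z => exp (g z / 2), (hg.div_const 2).cexp, ?_, fun z hz => ?_⟩
  · simp [hg0, Complex.exp_log ha0]
  · rw [← hge z hz, ← Complex.exp_nat_mul]
    congr 1
    push_cast
    ring

theorem exists_cos_eq {f : ℂ → ℂ} (hf : DifferentiableOn ℂ f (ball 0 1))
    (h1 : ∀ z ∈ ball (0 : ℂ) 1, f z ≠ 1) (h2 : ∀ z ∈ ball (0 : ℂ) 1, f z ≠ -1)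
    {α : ℂ} (hα : cos α = f 0) :
    ∃ g : ℂ → ℂ, DifferentiableOn ℂ g (ball 0 1) ∧ g 0 = α ∧
      ∀ z ∈ ball (0 : ℂ) 1, cos (g z) = f z := by
  obtain ⟨s, hs, hs0, hsq⟩ := exists_sq_eq (f := fun z => 1 - f z ^ 2) (a := sin α)
    ((differentiableOn_const 1).sub (hf.pow 2))
    (fun z hz h => by
      have : (f z - 1) * (f z + 1) = 0 := by linear_combination -h
      rcases mul_eq_zero.1 this with h | h
      · exact h1 z hz (sub_eq_zero.1 h)
      · exact h2 z hz (eq_neg_of_add_eq_zero_left h))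
    (by rw [← hα]; linear_combination Complex.sin_sq_add_cos_sq α)
  have hmul : ∀ z ∈ ball (0 : ℂ) 1, (f z + s z * I) * (f z - s z * I) = 1 := by
    intro z hz
    linear_combination hsq z hz - (s z) ^ 2 * Complex.I_sq
  obtain ⟨g, hg, hg0, hge⟩ := exists_exp_eq (f := fun z => f z + s z * I) (α := α * I)
    (hf.add (hs.mul_const I))
    (fun z hz h => by simpa [h] using hmul z hz)
    (by rw [Complex.exp_mul_I, hα, hs0])
  refine ⟨fun z => -I * g z, hg.const_mul _, ?_, fun z hz => ?_⟩
  · simp only [hg0]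
    linear_combination -α * Complex.I_sq
  · have e1 : -I * g z * I = g z := by linear_combination -(g z) * Complex.I_sq
    have e2 : -(-I * g z) * I = -g z := by linear_combination (g z) * Complex.I_sq
    have e3 : exp (-g z) = f z - s z * I := by
      rw [Complex.exp_neg, hge z hz]
      exact inv_eq_of_mul_eq_one_right (hmul z hz)
    rw [Complex.cos, e1, e2, e3, hge z hz]
    ring

/-! ### Bloch's theorem and a Landau-type bound -/

theorem norm_deriv_le_of_forall_not_ball_subset {f : ℂ → ℂ} {R : ℝ} (hR : 0 ≤ R)
    (hf : DifferentiableOn ℂ f (ball 0 1))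
    (hball : ∀ c : ℂ, ¬ ball c R ⊆ f '' ball 0 1) : ‖deriv f 0‖ ≤ 96 * R := by
  by_contra! hlt
  have hsub : closedBall (0 : ℂ) (1 / 2) ⊆ ball 0 1 := closedBall_subset_ball (by norm_num)
  have hf' : DifferentiableOn ℂ (deriv f) (ball 0 1) := hf.deriv isOpen_ball
  obtain ⟨z₀, hz₀, hmax⟩ := (isCompact_closedBall (0 : ℂ) (1 / 2)).exists_isMaxOn
    ⟨0, by simp⟩ (f := fun z => (1 / 2 - ‖z‖) * ‖deriv f z‖)
    (((continuous_const.sub continuous_norm).continuousOn).mul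
      (hf'.continuousOn.mono hsub).norm)
  have hmax' : ∀ z : ℂ, ‖z‖ ≤ 1 / 2 →
      (1 / 2 - ‖z‖) * ‖deriv f z‖ ≤ (1 / 2 - ‖z₀‖) * ‖deriv f z₀‖ :=
    fun z hz => hmax (by simpa using hz)
  set M := ‖deriv f z₀‖ with hM
  set ρ := (1 / 2 - ‖z₀‖) / 2 with hρ
  have hz₀' : ‖z₀‖ ≤ 1 / 2 := by simpa using hz₀
  have hMρ : 24 * R < M * ρ := by
    have := hmax' 0 (by simp)
    simp only [norm_zero, sub_zero] at this
    rw [hρ]; nlinarith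
  have hρ0 : 0 < ρ := by
    rcases (show 0 ≤ ρ by rw [hρ]; linarith).eq_or_lt with h | h
    · rw [← h] at hMρ; linarith
    · exact h
  have hM0 : 0 < M := by
    by_contra! h
    nlinarith
  have hin : ∀ z ∈ ball z₀ ρ, ‖z‖ < 1 / 2 - ρ := by
    intro z hz
    have h1 : ‖z - z₀‖ < ρ := by simpa [dist_eq_norm] using hz
    have h2 := norm_add_le (z - z₀) z₀
    rw [sub_add_cancel] at h2
    linarith
  have hin' : ball z₀ ρ ⊆ ball 0 1 := fun z hz => by
    have := hin z hz
    simp only [mem_ball_zero_iff]; linarith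
  have hd2 : ∀ z ∈ ball z₀ ρ, ‖deriv f z‖ ≤ 2 * M := by
    intro z hz
    have h1 := hin z hz
    have h2 := hmax' z (by linarith)
    have h3 : ρ * ‖deriv f z‖ ≤ (1 / 2 - ‖z‖) * ‖deriv f z‖ := by
      gcongr; linarith
    have h4 : ρ * ‖deriv f z‖ ≤ ρ * (2 * M) := by rw [hρ] at h3 ⊢; linarith
    exact le_of_mul_le_mul_left h4 hρ0
  have hd3 : ∀ z ∈ ball z₀ ρ, ‖deriv f z - deriv f z₀‖ ≤ 3 * M / ρ * ‖z - z₀‖ := by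
    intro z hz
    have := dist_le_div_mul_dist_of_mapsTo_ball (R₂ := 3 * M) (hf'.mono hin') (fun y hy => by
      rw [mem_closedBall, dist_eq_norm]
      have := norm_sub_le (deriv f y) (deriv f z₀)
      linarith [hd2 y hy]) hz
    simpa [dist_eq_norm] using this
  set r := ρ / 6 with hr
  have hr0 : 0 < r := by positivity
  have hrρ : closedBall z₀ r ⊆ ball z₀ ρ := closedBall_subset_ball (by rw [hr]; linarith)
  have hest : ∀ z ∈ closedBall z₀ r,
      ‖f z - f z₀ - deriv f z₀ * (z - z₀)‖ ≤ M / 2 * ‖z - z₀‖ := by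
    intro z hz
    have hmv := (convex_closedBall z₀ r).norm_image_sub_le_of_norm_hasDerivWithin_le
      (f := fun y => f y - deriv f z₀ * y) (f' := fun y => deriv f y - deriv f z₀ * 1)
      (C := M / 2)
      (fun y hy => (((hf y (hin' (hrρ hy))).differentiableAt
        (isOpen_ball.mem_nhds (hin' (hrρ hy)))).hasDerivAt.sub
          ((hasDerivAt_id y).const_mul (deriv f z₀))).hasDerivWithinAt)
      (fun y hy => by
        rw [mul_one]
        refine (hd3 y (hrρ hy)).trans ?_
        have : ‖y - z₀‖ ≤ ρ / 6 := by simpa [dist_eq_norm] using hy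
        calc 3 * M / ρ * ‖y - z₀‖ ≤ 3 * M / ρ * (ρ / 6) := by gcongr
          _ = M / 2 := by field_simp; norm_num)
      (mem_closedBall_self hr0.le) hz
    convert! hmv using 2
    ring
  have hlow : ∀ z ∈ sphere z₀ r, M * r / 2 ≤ ‖f z - f z₀‖ := by
    intro z hz
    have h1 := hest z (sphere_subset_closedBall hz)
    have h2 : ‖z - z₀‖ = r := by simpa [dist_eq_norm] using hz
    have h3 := norm_sub_norm_le (deriv f z₀ * (z - z₀)) (deriv f z₀ * (z - z₀) - (f z - f z₀))
    rw [sub_sub_cancel, norm_sub_rev (deriv f z₀ * (z - z₀)), norm_mul, h2, ← hM] at h3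
    rw [h2] at h1
    linarith
  have hdc : DiffContOnCl ℂ f (ball z₀ r) :=
    (hf.mono ((closure_ball_subset_closedBall.trans hrρ).trans hin')).diffContOnCl
  have hfreq : ∃ᶠ z in 𝓝 z₀, f z ≠ f z₀ := by
    have hz₀b : z₀ ∈ ball (0 : ℂ) 1 := hsub hz₀
    have hder := ((hf z₀ hz₀b).differentiableAt (isOpen_ball.mem_nhds hz₀b)).hasDerivAt
    have := hder.eventually_ne (c := f z₀) (norm_pos_iff.1 hM0)
    exact this.frequently.filter_mono nhdsWithin_le_nhds
  have himg := hdc.ball_subset_image_closedBall hr0 hlow hfreq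
  refine hball (f z₀) ((ball_subset_ball ?_).trans (himg.trans (image_mono (hrρ.trans hin'))))
  rw [hr]; linarith

theorem exists_cos_eq_int_dist_lt (c : ℂ) : ∃ ξ : ℂ, dist ξ c < 4 ∧ ∃ n : ℤ, cos ξ = n := by
  have key : ∀ y : ℝ, ∃ τ : ℝ, |τ - y| ≤ 2 ∧ ∃ m : ℤ, Real.cosh τ = m := by
    have pos : ∀ y : ℝ, 0 ≤ y → ∃ τ : ℝ, |τ - y| ≤ 2 ∧ ∃ m : ℤ, Real.cosh τ = m := by
      intro y hy
      have h2 : 2 ≤ Real.cosh 2 := by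
        rw [Real.cosh_eq]
        have := Real.quadratic_le_exp_of_nonneg (show (0 : ℝ) ≤ 2 by norm_num)
        have := Real.exp_pos (-2)
        linarith
      have h3 : Real.cosh y + 1 ≤ Real.cosh (y + 2) := by
        rw [Real.cosh_add]
        have h4 := Real.one_le_cosh y
        have h5 := Real.sinh_nonneg_iff.2 hy
        have h6 := Real.sinh_nonneg_iff.2 (show (0 : ℝ) ≤ 2 by norm_num)
        nlinarith [mul_nonneg h5 h6]
      obtain ⟨τ, hτ, hτe⟩ := intermediate_value_Icc (show y ≤ y + 2 by linarith)
        Real.continuous_cosh.continuousOn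
        (show ((⌈Real.cosh y⌉ : ℤ) : ℝ) ∈ Icc (Real.cosh y) (Real.cosh (y + 2)) from
          ⟨Int.le_ceil _, ((Int.ceil_lt_add_one _).le).trans h3⟩)
      exact ⟨τ, by rw [abs_le]; constructor <;> linarith [hτ.1, hτ.2], _, hτe⟩
    intro y
    rcases le_total 0 y with hy | hy
    · exact pos y hy
    · obtain ⟨τ, h1, m, h2⟩ := pos (-y) (by linarith)
      refine ⟨-τ, ?_, m, by rw [Real.cosh_neg, h2]⟩
      rw [← abs_neg]; convert! h1 using 2; ring
  obtain ⟨τ, hτ, m, hm⟩ := key c.im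
  set k : ℤ := round (c.re / Real.pi) with hk
  have hkd : |(k : ℝ) * Real.pi - c.re| ≤ Real.pi / 2 := by
    have h1 := abs_sub_round (c.re / Real.pi)
    have h2 : (k : ℝ) * Real.pi - c.re = -((c.re / Real.pi - k) * Real.pi) := by
      field_simp [Real.pi_ne_zero]; ring
    rw [h2, abs_neg, abs_mul, abs_of_pos Real.pi_pos]
    nlinarith [Real.pi_pos]
  refine ⟨((k : ℝ) * Real.pi : ℝ) + (τ : ℝ) * I, ?_, ?_⟩
  · rw [dist_eq_norm]
    refine (Complex.norm_le_abs_re_add_abs_im _).trans_lt ?_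
    simp only [sub_re, add_re, ofReal_re, mul_re, I_re, mul_zero, ofReal_im, I_im, mul_one,
      sub_self, add_zero, sub_im, add_im, mul_im, zero_add]
    linarith [Real.pi_lt_four]
  · have hs : Complex.sin (((k : ℝ) * Real.pi : ℝ) : ℂ) = 0 := by
      push_cast
      exact Complex.sin_int_mul_pi k
    have hc : ∃ j : ℤ, Complex.cos (((k : ℝ) * Real.pi : ℝ) : ℂ) = j := by
      refine ⟨(-1) ^ k.natAbs, ?_⟩
      rw [← Complex.ofReal_cos, Real.cos_int_mul_pi]
      rcases Int.even_or_odd k with h | h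
      · rw [h.neg_one_zpow, (Int.natAbs_even.2 h).neg_one_pow]; simp
      · rw [h.neg_one_zpow, (Int.natAbs_odd.2 h).neg_one_pow]; simp
    obtain ⟨j, hj⟩ := hc
    refine ⟨j * m, ?_⟩
    rw [Complex.cos_add, hs, hj, Complex.cos_mul_I, ← Complex.ofReal_cosh, hm]
    push_cast; ring

theorem exists_norm_deriv_le_of_omits (a : ℂ) : ∃ C : ℝ, ∀ f : ℂ → ℂ,
    DifferentiableOn ℂ f (ball 0 1) → (∀ z ∈ ball (0 : ℂ) 1, f z ≠ 1) →
    (∀ z ∈ ball (0 : ℂ) 1, f z ≠ -1) → f 0 = a → ‖deriv f 0‖ ≤ C := by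
  obtain ⟨α, hα⟩ := Complex.cos_surjective a
  obtain ⟨β, hβ⟩ := Complex.cos_surjective (α / Real.pi)
  refine ⟨‖sin α‖ * Real.pi * ‖sin β‖ * (96 * 4), fun f hf h1 h2 h0 => ?_⟩
  have hpi : (Real.pi : ℂ) ≠ 0 := by exact_mod_cast Real.pi_ne_zero
  obtain ⟨g, hg, hg0, hgf⟩ := exists_cos_eq hf h1 h2 (hα.trans h0.symm)
  have hgint : ∀ z ∈ ball (0 : ℂ) 1, ∀ n : ℤ, g z / Real.pi ≠ n := by
    intro z hz n hn
    rw [div_eq_iff hpi] at hn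
    have h3 := hgf z hz
    have h4 := Complex.sin_sq_add_cos_sq (g z)
    rw [hn] at h3 h4
    rw [Complex.sin_int_mul_pi, h3] at h4
    have : (f z - 1) * (f z + 1) = 0 := by linear_combination h4
    rcases mul_eq_zero.1 this with h | h
    · exact h1 z hz (sub_eq_zero.1 h)
    · exact h2 z hz (eq_neg_of_add_eq_zero_left h)
  obtain ⟨k, hk, hk0, hkg⟩ := exists_cos_eq (f := fun z => g z / Real.pi) (α := β)
    (hg.div_const _) (fun z hz => by simpa using hgint z hz 1)
    (fun z hz => by simpa using hgint z hz (-1)) (by rw [hβ, hg0])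
  have hkd : ‖deriv k 0‖ ≤ 96 * 4 := by
    refine norm_deriv_le_of_forall_not_ball_subset (by norm_num) hk fun c hc => ?_
    obtain ⟨ξ, hξ, n, hn⟩ := exists_cos_eq_int_dist_lt c
    obtain ⟨z, hz, rfl⟩ := hc hξ
    exact hgint z hz n (by rw [← hkg z hz, hn])
  have hnhds : ball (0 : ℂ) 1 ∈ 𝓝 (0 : ℂ) := ball_mem_nhds _ one_pos
  have dk := (hk.differentiableAt hnhds).hasDerivAt
  have dg : HasDerivAt g (-sin β * deriv k 0 * Real.pi) 0 := by
    have h3 : HasDerivAt (fun z => cos (k z) * Real.pi) (-sin β * deriv k 0 * Real.pi) 0 := by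
      simpa [hk0] using dk.ccos.mul_const (Real.pi : ℂ)
    refine h3.congr_of_eventuallyEq ?_
    filter_upwards [hnhds] with z hz
    rw [hkg z hz, div_mul_cancel₀ _ hpi]
  have df : HasDerivAt f (-sin α * (-sin β * deriv k 0 * Real.pi)) 0 := by
    have h3 := dg.ccos
    rw [hg0] at h3
    refine h3.congr_of_eventuallyEq ?_
    filter_upwards [hnhds] with z hz
    rw [hgf z hz]
  rw [df.deriv]
  simp only [norm_mul, norm_neg, Complex.norm_real, Real.norm_eq_abs, abs_of_pos Real.pi_pos]
  calc ‖sin α‖ * (‖sin β‖ * ‖deriv k 0‖ * Real.pi)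
      = ‖sin α‖ * Real.pi * ‖sin β‖ * ‖deriv k 0‖ := by ring
    _ ≤ _ := by have := Real.pi_pos; gcongr

/-! ### Hurwitz maps -/

/-- `h` maps the unit disk holomorphically into `D` and takes the value `w` exactly at `0`. -/
def IsHurwitzMap (D : Set ℂ) (w : ℂ) (h : ℂ → ℂ) : Prop :=
  DifferentiableOn ℂ h (ball 0 1) ∧ MapsTo h (ball 0 1) D ∧ h 0 = w ∧
    ∀ t ∈ ball (0 : ℂ) 1, t ≠ 0 → h t ≠ w

theorem IsHurwitzMap.mono {D E : Set ℂ} {w : ℂ} {h : ℂ → ℂ} (hh : IsHurwitzMap D w h)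
    (hDE : D ⊆ E) : IsHurwitzMap E w h :=
  ⟨hh.1, hh.2.1.mono_right hDE, hh.2.2⟩

theorem IsHurwitzMap.differentiableAt {D : Set ℂ} {w : ℂ} {h : ℂ → ℂ}
    (hh : IsHurwitzMap D w h) : DifferentiableAt ℂ h 0 :=
  hh.1.differentiableAt (ball_mem_nhds _ one_pos)

/-- Precomposition with `z ↦ u * z`, where `0 < ‖u‖ ≤ 1`. -/
theorem IsHurwitzMap.comp_mul {D : Set ℂ} {w : ℂ} {h : ℂ → ℂ} (hh : IsHurwitzMap D w h)
    {u : ℂ} (hu : ‖u‖ ≤ 1) (hu0 : u ≠ 0) :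
    IsHurwitzMap D w (fun z => h (u * z)) ∧ deriv (fun z => h (u * z)) 0 = u * deriv h 0 := by
  have hmaps : MapsTo (fun z : ℂ => u * z) (ball 0 1) (ball 0 1) := fun z hz => by
    simp only [mem_ball_zero_iff, norm_mul] at hz ⊢
    exact (mul_le_of_le_one_left (norm_nonneg z) hu).trans_lt hz
  refine ⟨⟨hh.1.comp (differentiableOn_id.const_mul u) hmaps,
    hh.2.1.comp hmaps, by simpa using hh.2.2.1,
    fun t ht h0 => hh.2.2.2 _ (hmaps ht) (mul_ne_zero hu0 h0)⟩, ?_⟩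
  have h1 := hh.differentiableAt.hasDerivAt
  have h2 : HasDerivAt (fun z : ℂ => u * z) u 0 := by simpa using (hasDerivAt_id (0 : ℂ)).const_mul u
  have h3 : HasDerivAt (fun z => h (u * z)) (deriv h 0 * u) 0 :=
    HasDerivAt.comp (h₂ := h) 0 (by simpa using h1) h2
  rw [h3.deriv, mul_comm]

theorem isHurwitzMap_affine {D : Set ℂ} {w : ℂ} {s : ℝ} (hs : 0 < s) (hD : ball w s ⊆ D) :
    IsHurwitzMap D w (fun t => w + s * t) ∧ deriv (fun t : ℂ => w + s * t) 0 = s := by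
  have hs' : (s : ℂ) ≠ 0 := by exact_mod_cast hs.ne'
  refine ⟨⟨by fun_prop, fun t ht => hD ?_, by simp, fun t _ h0 => by simp [hs', h0]⟩, ?_⟩
  · simp only [mem_ball_zero_iff] at ht
    simp only [mem_ball, dist_self_add_left, norm_mul, Complex.norm_real, Real.norm_eq_abs,
      abs_of_pos hs]
    nlinarith
  · have : HasDerivAt (fun t : ℂ => w + s * t) s 0 := by
      simpa using ((hasDerivAt_id (0 : ℂ)).const_mul (s : ℂ)).const_add w
    exact this.deriv

theorem hurwitzRadius_nonneg (D : Set ℂ) (w : ℂ) : 0 ≤ hurwitzRadius D w :=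
  Real.sSup_nonneg fun _ hr => hr.1.le

theorem hurwitzRadius_le {D : Set ℂ} {w : ℂ} {C : ℝ} (hC : 0 ≤ C)
    (h : ∀ f, IsHurwitzMap D w f → ‖deriv f 0‖ ≤ C) : hurwitzRadius D w ≤ C := by
  refine Real.sSup_le ?_ hC
  rintro r ⟨hr, f, h1, h2, h3, h4, h5⟩
  have := h f ⟨h1, h2, h3, h4⟩
  rwa [h5, Complex.norm_real, Real.norm_eq_abs, abs_of_pos hr] at this

theorem IsHurwitzMap.norm_deriv_le_hurwitzRadius {D : Set ℂ} {w : ℂ} {h : ℂ → ℂ}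
    (hh : IsHurwitzMap D w h) (hbdd : ∃ C, ∀ f, IsHurwitzMap D w f → ‖deriv f 0‖ ≤ C) :
    ‖deriv h 0‖ ≤ hurwitzRadius D w := by
  rcases eq_or_ne (deriv h 0) 0 with h0 | h0
  · rw [h0, norm_zero]
    exact hurwitzRadius_nonneg D w
  have hn : ‖deriv h 0‖ ≠ 0 := norm_ne_zero_iff.2 h0
  have hnC : (‖deriv h 0‖ : ℂ) ≠ 0 := by exact_mod_cast hn
  have hu : ‖(‖deriv h 0‖ : ℂ) / deriv h 0‖ = 1 := by
    rw [norm_div, Complex.norm_real, norm_norm, div_self hn]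
  obtain ⟨h1, h2⟩ := hh.comp_mul hu.le (div_ne_zero hnC h0)
  obtain ⟨C, hC⟩ := hbdd
  refine le_csSup ⟨C, ?_⟩ ⟨(norm_pos_iff.2 h0), _, h1.1, h1.2.1, h1.2.2.1, h1.2.2.2, ?_⟩
  · rintro r ⟨hr, f, h1, h2, h3, h4, h5⟩
    have := hC f ⟨h1, h2, h3, h4⟩
    rwa [h5, Complex.norm_real, Real.norm_eq_abs, abs_of_pos hr] at this
  · rw [h2, div_mul_cancel₀ _ h0]

theorem exists_norm_deriv_hurwitzMap_le {D : Set ℂ} (hD : D ≠ univ) {w : ℂ} (hw : w ∈ D) :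
    ∃ C, ∀ f, IsHurwitzMap D w f → ‖deriv f 0‖ ≤ C := by
  obtain ⟨b, hb⟩ := (Set.ne_univ_iff_exists_notMem D).1 hD
  have hbw : b - w ≠ 0 := sub_ne_zero.2 (by rintro rfl; exact hb hw)
  obtain ⟨C, hC⟩ := exists_norm_deriv_le_of_omits 3
  refine ⟨‖b - w‖ * C, fun f hf => ?_⟩
  obtain ⟨hfd, hfm, hf0, hfw⟩ := hf
  obtain ⟨g, hg, hg0, hgsq⟩ := exists_sq_eq (f := fun z => 1 - (f z - w) / (b - w)) (a := 1)
    ((differentiableOn_const 1).sub ((hfd.sub_const w).div_const _))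
    (fun z hz h => by
      rw [sub_eq_zero, eq_comm, div_eq_one_iff_eq hbw, sub_left_inj] at h
      exact hb (h ▸ hfm hz))
    (by simp [hf0])
  have hgf : ∀ z ∈ ball (0 : ℂ) 1, f z = w + (b - w) * (1 - g z ^ 2) := by
    intro z hz
    rw [hgsq z hz]
    field_simp
    ring
  have hnhds : ball (0 : ℂ) 1 ∈ 𝓝 (0 : ℂ) := ball_mem_nhds _ one_pos
  have dg := (hg.differentiableAt hnhds).hasDerivAt
  have dF : HasDerivAt (fun z => 2 * g z + 1) (2 * deriv g 0) 0 := (dg.const_mul 2).add_const 1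
  have df : HasDerivAt f ((b - w) * -(2 * deriv g 0)) 0 := by
    have h1 : HasDerivAt (fun z => w + (b - w) * (1 - g z ^ 2))
        ((b - w) * -(2 * deriv g 0)) 0 := by
      simpa [hg0] using (((dg.pow 2).const_sub 1).const_mul (b - w)).const_add w
    refine h1.congr_of_eventuallyEq ?_
    filter_upwards [hnhds] with z hz using hgf z hz
  rw [df.deriv, norm_mul, norm_neg, ← dF.deriv]
  gcongr
  refine hC _ ((hg.const_mul 2).add_const 1) (fun z hz h => ?_) (fun z hz h => ?_) ?_
  · have h0 : g z = 0 := by linear_combination h / 2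
    have := hgf z hz
    rw [h0] at this
    exact hb (by convert! hfm hz using 1; rw [this]; ring)
  · have h0 : g z = -1 := by linear_combination h / 2
    have h1 := hgf z hz
    rw [h0] at h1
    have hz0 : z = 0 := by
      by_contra hne
      exact hfw z hz hne (by rw [h1]; ring)
    rw [hz0, hg0] at h0
    norm_num at h0
  · rw [hg0]; norm_num

theorem hurwitzRadius_pos {D : Set ℂ} (hDo : IsOpen D) (hD : D ≠ univ) {w : ℂ} (hw : w ∈ D) :
    0 < hurwitzRadius D w := by
  obtain ⟨s, hs, hsD⟩ := Metric.isOpen_iff.1 hDo w hw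
  obtain ⟨h1, h2⟩ := isHurwitzMap_affine hs hsD
  have := h1.norm_deriv_le_hurwitzRadius (exists_norm_deriv_hurwitzMap_le hD hw)
  rw [h2, Complex.norm_real, Real.norm_eq_abs, abs_of_pos hs] at this
  exact hs.trans_le this

theorem hurwitzRadius_mono {D E : Set ℂ} (hDE : D ⊆ E) (hE : E ≠ univ) {w : ℂ} (hw : w ∈ E) :
    hurwitzRadius D w ≤ hurwitzRadius E w :=
  hurwitzRadius_le (hurwitzRadius_nonneg E w) fun _ hf =>
    (hf.mono hDE).norm_deriv_le_hurwitzRadius (exists_norm_deriv_hurwitzMap_le hE hw)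

/-! ### Disk automorphisms and two-sheeted Blaschke maps -/

/-- The automorphism of the unit disk sending `0` to `c` and `-c` to `0`. -/
def diskShift (c z : ℂ) : ℂ := (z + c) / (1 + conj c * z)

theorem one_add_conj_mul_ne_zero {c z : ℂ} (hc : ‖c‖ < 1) (hz : ‖z‖ < 1) :
    1 + conj c * z ≠ 0 := by
  intro h
  have h1 : ‖conj c * z‖ = 1 := by
    rw [eq_neg_of_add_eq_zero_right h, norm_neg, norm_one]
  rw [norm_mul, Complex.norm_conj] at h1
  nlinarith [norm_nonneg c, norm_nonneg z]

theorem one_sub_sq_norm_diskShift {c z : ℂ} (hc : ‖c‖ < 1) (hz : ‖z‖ < 1) :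
    1 - ‖diskShift c z‖ ^ 2 =
      (1 - ‖c‖ ^ 2) * (1 - ‖z‖ ^ 2) / ‖1 + conj c * z‖ ^ 2 := by
  have h := one_add_conj_mul_ne_zero hc hz
  have hn : ‖1 + conj c * z‖ ^ 2 ≠ 0 := pow_ne_zero _ (norm_ne_zero_iff.2 h)
  rw [diskShift, norm_div, div_pow, eq_div_iff hn, sub_mul, div_mul_cancel₀ _ hn, one_mul]
  simp only [Complex.sq_norm, Complex.normSq_apply, add_re, add_im, mul_re, mul_im, conj_re,
    conj_im, one_re, one_im]
  ring

theorem norm_diskShift_lt_one {c z : ℂ} (hc : ‖c‖ < 1) (hz : ‖z‖ < 1) :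
    ‖diskShift c z‖ < 1 := by
  have h := one_sub_sq_norm_diskShift hc hz
  have hn : 0 < ‖1 + conj c * z‖ := norm_pos_iff.2 (one_add_conj_mul_ne_zero hc hz)
  have h1 : 0 < 1 - ‖c‖ ^ 2 := by nlinarith [norm_nonneg c]
  have h2 : 0 < 1 - ‖z‖ ^ 2 := by nlinarith [norm_nonneg z]
  have h3 : 0 < 1 - ‖diskShift c z‖ ^ 2 := by rw [h]; positivity
  nlinarith [norm_nonneg (diskShift c z)]

theorem mapsTo_diskShift {c : ℂ} (hc : ‖c‖ < 1) :
    MapsTo (diskShift c) (ball 0 1) (ball 0 1) := fun z hz => by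
  simp only [mem_ball_zero_iff] at hz ⊢
  exact norm_diskShift_lt_one hc hz

theorem sq_norm_diskShift_le {c z : ℂ} {ρ τ : ℝ} (hc : ‖c‖ ≤ ρ) (hρ : ρ < 1) (hz : ‖z‖ ≤ τ)
    (hτ : τ < 1) : ‖diskShift c z‖ ^ 2 ≤ 1 - (1 - ρ ^ 2) * (1 - τ ^ 2) / 4 := by
  have hc1 := hc.trans_lt hρ
  have hz1 := hz.trans_lt hτ
  have hn : 0 < ‖1 + conj c * z‖ := norm_pos_iff.2 (one_add_conj_mul_ne_zero hc1 hz1)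
  have hn2 : ‖1 + conj c * z‖ ^ 2 ≤ 4 := by
    have h1 := norm_add_le 1 (conj c * z)
    rw [norm_one, norm_mul, Complex.norm_conj] at h1
    have h2 : ‖c‖ * ‖z‖ ≤ 1 := mul_le_one₀ hc1.le (norm_nonneg _) hz1.le
    nlinarith
  have h1 : 1 - ρ ^ 2 ≤ 1 - ‖c‖ ^ 2 := by gcongr
  have h2 : 1 - τ ^ 2 ≤ 1 - ‖z‖ ^ 2 := by gcongr
  have h3 : 0 < 1 - τ ^ 2 := by nlinarith [(norm_nonneg z).trans hz]
  have h3' : 0 < 1 - ρ ^ 2 := by nlinarith [(norm_nonneg c).trans hc]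
  have h4 : (1 - ρ ^ 2) * (1 - τ ^ 2) / 4 ≤
      (1 - ‖c‖ ^ 2) * (1 - ‖z‖ ^ 2) / ‖1 + conj c * z‖ ^ 2 := by
    have : 0 ≤ (1 - ‖c‖ ^ 2) * (1 - ‖z‖ ^ 2) := mul_nonneg (by linarith) (by linarith)
    gcongr
    linarith
  rw [← one_sub_sq_norm_diskShift hc1 hz1] at h4
  linarith

theorem diskShift_neg_diskShift {c z : ℂ} (hc : ‖c‖ < 1) (hz : ‖z‖ < 1) :
    diskShift (-c) (diskShift c z) = z := by
  have h1 := one_add_conj_mul_ne_zero hc hz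
  have h2 := one_add_conj_mul_ne_zero (c := -c) (by rwa [norm_neg]) (norm_diskShift_lt_one hc hz)
  rw [diskShift, div_eq_iff h2, diskShift, map_neg]
  set d := 1 + conj c * z with hd
  field_simp
  rw [hd]
  ring

theorem diskShift_diskShift_neg {c z : ℂ} (hc : ‖c‖ < 1) (hz : ‖z‖ < 1) :
    diskShift c (diskShift (-c) z) = z := by
  simpa using diskShift_neg_diskShift (c := -c) (by rwa [norm_neg]) hz

theorem diskShift_zero (c : ℂ) : diskShift c 0 = c := by simp [diskShift]

theorem diskShift_neg_self (c : ℂ) : diskShift c (-c) = 0 := by simp [diskShift]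

theorem hasDerivAt_diskShift {c z : ℂ} (hc : ‖c‖ < 1) (hz : ‖z‖ < 1) :
    HasDerivAt (diskShift c) ((1 - conj c * c) / (1 + conj c * z) ^ 2) z := by
  have h1 := one_add_conj_mul_ne_zero hc hz
  have h2 : HasDerivAt (fun z => 1 + conj c * z) (conj c) z := by
    simpa using ((hasDerivAt_id z).const_mul (conj c)).const_add 1
  convert! ((hasDerivAt_id z).add_const c).div h2 h1 using 1
  simp only [id]
  ring

theorem differentiableOn_diskShift {c : ℂ} (hc : ‖c‖ < 1) :
    DifferentiableOn ℂ (diskShift c) (ball 0 1) := fun z hz =>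
  (hasDerivAt_diskShift hc (by simpa using hz)).differentiableAt.differentiableWithinAt

/-- The two-sheeted self-map of the disk fixing `0`, branched over `-b ^ 2`. -/
def blaschkeSq (b z : ℂ) : ℂ := diskShift (-b ^ 2) (diskShift b z ^ 2)

theorem norm_neg_sq_lt_one {b : ℂ} (hb : ‖b‖ < 1) : ‖-b ^ 2‖ < 1 := by
  rw [norm_neg, norm_pow]
  exact pow_lt_one₀ (norm_nonneg b) hb two_ne_zero

theorem norm_sq_diskShift_lt_one {b z : ℂ} (hb : ‖b‖ < 1) (hz : ‖z‖ < 1) :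
    ‖diskShift b z ^ 2‖ < 1 := by
  rw [norm_pow]
  exact pow_lt_one₀ (norm_nonneg _) (norm_diskShift_lt_one hb hz) two_ne_zero

theorem differentiableOn_blaschkeSq {b : ℂ} (hb : ‖b‖ < 1) :
    DifferentiableOn ℂ (blaschkeSq b) (ball 0 1) :=
  (differentiableOn_diskShift (norm_neg_sq_lt_one hb)).comp
    ((differentiableOn_diskShift hb).pow 2) fun z hz => by
      simp only [mem_ball_zero_iff] at hz ⊢
      exact norm_sq_diskShift_lt_one hb hz

theorem blaschkeSq_zero (b : ℂ) : blaschkeSq b 0 = 0 := by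
  have := diskShift_neg_self (-b ^ 2)
  rw [neg_neg] at this
  rw [blaschkeSq, diskShift_zero, this]

theorem blaschkeSq_eq_zero {b z : ℂ} (hb : ‖b‖ < 1) (hz : ‖z‖ < 1) (h : blaschkeSq b z = 0) :
    z = 0 ∨ z = diskShift (-b) (-b) := by
  have h1 := diskShift_neg_diskShift (norm_neg_sq_lt_one hb) (norm_sq_diskShift_lt_one hb hz)
  rw [← blaschkeSq, h, diskShift_zero, neg_neg] at h1
  rcases sq_eq_sq_iff_eq_or_eq_neg.1 h1 with h2 | h2
  · left
    have h3 := diskShift_neg_self (-b)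
    rw [neg_neg] at h3
    rw [← diskShift_neg_diskShift hb hz, ← h2, h3]
  · right
    rw [← diskShift_neg_diskShift hb hz, ← neg_eq_iff_eq_neg.2 h2]

theorem norm_deriv_blaschkeSq {b : ℂ} (hb : ‖b‖ < 1) :
    ‖deriv (blaschkeSq b) 0‖ = 2 * ‖b‖ / (1 + ‖b‖ ^ 2) := by
  have h1 := hasDerivAt_diskShift hb (z := 0) (by simp)
  have h2 := h1.pow 2
  have hbb : conj b * b = ((‖b‖ ^ 2 : ℝ) : ℂ) := by
    rw [mul_comm, Complex.mul_conj, Complex.normSq_eq_norm_sq]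
  have h3 : HasDerivAt (diskShift (-b ^ 2)) _ (diskShift b 0 ^ 2) :=
    hasDerivAt_diskShift (norm_neg_sq_lt_one hb)
      (norm_sq_diskShift_lt_one hb (z := 0) (by simp))
  have h4 : HasDerivAt (blaschkeSq b) _ 0 := HasDerivAt.comp 0 h3 h2
  rw [h4.deriv, diskShift_zero]
  have e : conj (-b ^ 2) * b ^ 2 = -((‖b‖ ^ 4 : ℝ) : ℂ) := by
    rw [map_neg, map_pow, neg_mul, ← mul_pow, hbb]; push_cast; ring
  have e' : conj (-b ^ 2) * -b ^ 2 = ((‖b‖ ^ 4 : ℝ) : ℂ) := by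
    rw [mul_neg, e, neg_neg]
  have hβ := norm_nonneg b
  have hβ2 : ‖b‖ ^ 2 < 1 := pow_lt_one₀ hβ hb two_ne_zero
  have hβ4 : ‖b‖ ^ 4 < 1 := pow_lt_one₀ hβ hb four_ne_zero
  rw [e, e', hbb]
  have e1 : (1 : ℂ) - ((‖b‖ ^ 4 : ℝ) : ℂ) = ((1 - ‖b‖ ^ 4 : ℝ) : ℂ) := by push_cast; ring
  have e2 : (1 : ℂ) + -((‖b‖ ^ 4 : ℝ) : ℂ) = ((1 - ‖b‖ ^ 4 : ℝ) : ℂ) := by push_cast; ring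
  have e3 : (1 : ℂ) - ((‖b‖ ^ 2 : ℝ) : ℂ) = ((1 - ‖b‖ ^ 2 : ℝ) : ℂ) := by push_cast; ring
  rw [e1, e2, e3]
  simp only [norm_mul, norm_div, norm_pow, Complex.norm_real, Real.norm_eq_abs,
    abs_of_pos (sub_pos.2 hβ4), abs_of_pos (sub_pos.2 hβ2), mul_zero, add_zero, norm_one]
  have n4 : (1 - ‖b‖ ^ 4) ≠ 0 := (sub_pos.2 hβ4).ne'
  have n2 : (1 + ‖b‖ ^ 2) ≠ 0 := by positivity
  field_simp
  norm_num
  ring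

/-- A self-map of the disk that omits the branch value of `blaschkeSq b` lifts through it. -/
theorem exists_blaschkeSq_lift {b : ℂ} (hb : ‖b‖ < 1) {g : ℂ → ℂ}
    (hg : DifferentiableOn ℂ g (ball 0 1)) (hgm : MapsTo g (ball 0 1) (ball 0 1))
    (hgb : ∀ t ∈ ball (0 : ℂ) 1, g t ≠ -b ^ 2) {z : ℂ} (hz : ‖z‖ < 1)
    (hgz : blaschkeSq b z = g 0) :
    ∃ k : ℂ → ℂ, DifferentiableOn ℂ k (ball 0 1) ∧ MapsTo k (ball 0 1) (ball 0 1) ∧ k 0 = z ∧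
      ∀ t ∈ ball (0 : ℂ) 1, blaschkeSq b (k t) = g t := by
  have hb2 := norm_neg_sq_lt_one hb
  have hb2' : ‖-(-b ^ 2)‖ < 1 := by rwa [norm_neg]
  have hbn : ‖-b‖ < 1 := by rwa [norm_neg]
  have hgn : ∀ t ∈ ball (0 : ℂ) 1, ‖g t‖ < 1 := fun t ht => by simpa using hgm ht
  obtain ⟨s, hs, hs0, hsq⟩ := exists_sq_eq (f := fun t => diskShift (-(-b ^ 2)) (g t))
    (a := diskShift b z)
    ((differentiableOn_diskShift hb2').comp hg hgm)
    (fun t ht h => hgb t ht (by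
      rw [← diskShift_diskShift_neg hb2 (hgn t ht), h, diskShift_zero]))
    (by
      rw [← hgz, blaschkeSq, diskShift_neg_diskShift hb2 (norm_sq_diskShift_lt_one hb hz)])
  have hsm : MapsTo s (ball 0 1) (ball 0 1) := fun t ht => by
    have h1 := norm_diskShift_lt_one hb2' (hgn t ht)
    rw [← hsq t ht, norm_pow] at h1
    rw [mem_ball_zero_iff]
    exact (pow_lt_one_iff_of_nonneg (norm_nonneg _) two_ne_zero).1 h1
  refine ⟨fun t => diskShift (-b) (s t), (differentiableOn_diskShift hbn).comp hs hsm,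
    (mapsTo_diskShift hbn).comp hsm, ?_, fun t ht => ?_⟩
  · simp only
    rw [hs0, diskShift_neg_diskShift hb hz]
  · rw [blaschkeSq, diskShift_diskShift_neg hb (by simpa using hsm ht), hsq t ht,
      diskShift_diskShift_neg hb2 (hgn t ht)]

/-- Quantitative Schwarz lemma for self-maps of the disk that omit a value. -/
theorem norm_deriv_le_of_omits {b : ℂ} (hb : ‖b‖ < 1) {g : ℂ → ℂ}
    (hg : DifferentiableOn ℂ g (ball 0 1)) (hgm : MapsTo g (ball 0 1) (ball 0 1))
    (hgb : ∀ t ∈ ball (0 : ℂ) 1, g t ≠ -b ^ 2) (hg0 : g 0 = 0) :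
    ‖deriv g 0‖ ≤ 2 * ‖b‖ / (1 + ‖b‖ ^ 2) := by
  obtain ⟨k, hk, hkm, hk0, hkg⟩ := exists_blaschkeSq_lift hb hg hgm hgb (z := 0) (by simp)
    (by rw [blaschkeSq_zero, hg0])
  have hnhds : ball (0 : ℂ) 1 ∈ 𝓝 (0 : ℂ) := ball_mem_nhds _ one_pos
  have dk := (hk.differentiableAt hnhds).hasDerivAt
  have dB := ((differentiableOn_blaschkeSq hb).differentiableAt hnhds).hasDerivAt
  have dg : HasDerivAt g (deriv (blaschkeSq b) 0 * deriv k 0) 0 := by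
    refine (HasDerivAt.comp (h₂ := blaschkeSq b) 0 (by rwa [hk0]) dk).congr_of_eventuallyEq ?_
    filter_upwards [hnhds] with t ht using (hkg t ht).symm
  have h1 : ‖deriv k 0‖ ≤ 1 := norm_deriv_le_one_of_mapsTo_ball hk
    (by rw [hk0]; exact hkm.mono_right ball_subset_closedBall) one_pos
  rw [dg.deriv, norm_mul, norm_deriv_blaschkeSq hb]
  exact mul_le_of_le_one_right (by positivity) h1

/-! ### Hurwitz covers -/

/-- `p : W → D`, with `W` a subset of the unit disk, takes the value `w` exactly at `0` and has the
lifting property for Hurwitz maps into `D` at `w` and for disks in `D \ {w}`. -/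
structure IsHurwitzCover (D : Set ℂ) (w : ℂ) (p : ℂ → ℂ) (W : Set ℂ) : Prop where
  isOpen : IsOpen W
  subset : W ⊆ ball 0 1
  zero_mem : (0 : ℂ) ∈ W
  differentiableOn : DifferentiableOn ℂ p W
  mapsTo : MapsTo p W D
  map_zero : p 0 = w
  eq_zero : ∀ z ∈ W, p z = w → z = 0
  lift_hurwitz : ∀ h, IsHurwitzMap D w h → ∃ g : ℂ → ℂ, DifferentiableOn ℂ g (ball 0 1) ∧
    MapsTo g (ball 0 1) W ∧ g 0 = 0 ∧ ∀ t ∈ ball (0 : ℂ) 1, p (g t) = h t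
  lift_disk : ∀ h : ℂ → ℂ, DifferentiableOn ℂ h (ball 0 1) → MapsTo h (ball 0 1) (D \ {w}) →
    ∀ z ∈ W, p z = h 0 → ∃ g : ℂ → ℂ, DifferentiableOn ℂ g (ball 0 1) ∧
      MapsTo g (ball 0 1) W ∧ g 0 = z ∧ ∀ t ∈ ball (0 : ℂ) 1, p (g t) = h t

theorem isHurwitzCover_affine {D : Set ℂ} (hD : IsOpen D) {w : ℂ} (hw : w ∈ D) {R : ℝ}
    (hR : 0 < R) (hDR : D ⊆ ball w R) :
    IsHurwitzCover D w (fun z => w + R * z) {z | w + R * z ∈ D} := by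
  have hRC : (R : ℂ) ≠ 0 := by exact_mod_cast hR.ne'
  have hinv : ∀ y : ℂ, w + R * ((y - w) / R) = y := fun y => by field_simp; ring
  refine ⟨hD.preimage (by fun_prop), fun z hz => ?_, by simpa using hw, by fun_prop,
    fun z hz => hz, by simp, fun z _ h => by simpa [hRC] using h, fun h hh => ?_,
    fun h hh hm z _ hz => ?_⟩
  · have h1 := hDR hz
    simp only [mem_ball, dist_self_add_left, norm_mul, Complex.norm_real, Real.norm_eq_abs,
      abs_of_pos hR] at h1
    rw [mem_ball_zero_iff]
    exact (mul_lt_iff_lt_one_right hR).1 h1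
  · refine ⟨fun t => (h t - w) / R, (hh.1.sub_const w).div_const _, fun t ht => ?_,
      by simp [hh.2.2.1], fun t _ => hinv _⟩
    simpa only [mem_ofPred_eq, hinv] using hh.2.1 ht
  · refine ⟨fun t => (h t - w) / R, (hh.sub_const w).div_const _, fun t ht => ?_, ?_,
      fun t _ => hinv _⟩
    · simpa only [mem_ofPred_eq, hinv] using (hm ht).1
    · simp only
      rw [← hz]; field_simp; ring

namespace IsHurwitzCover

variable {D W : Set ℂ} {w : ℂ} {p : ℂ → ℂ}

theorem differentiableAt_zero (hp : IsHurwitzCover D w p W) : DifferentiableAt ℂ p 0 :=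
  hp.differentiableOn.differentiableAt (hp.isOpen.mem_nhds hp.zero_mem)

theorem deriv_eq_mul (hp : IsHurwitzCover D w p W) {g h : ℂ → ℂ}
    (hg : DifferentiableOn ℂ g (ball 0 1)) (hg0 : g 0 = 0)
    (hpg : ∀ t ∈ ball (0 : ℂ) 1, p (g t) = h t) : deriv h 0 = deriv p 0 * deriv g 0 := by
  have hnhds : ball (0 : ℂ) 1 ∈ 𝓝 (0 : ℂ) := ball_mem_nhds _ one_pos
  have h1 : HasDerivAt h (deriv p 0 * deriv g 0) 0 := by
    refine (HasDerivAt.comp (h₂ := p) 0 (by rw [hg0]; exact hp.differentiableAt_zero.hasDerivAt)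
      (hg.differentiableAt hnhds).hasDerivAt).congr_of_eventuallyEq ?_
    filter_upwards [hnhds] with t ht using (hpg t ht).symm
  exact h1.deriv

/-- If `W` omits a point of the disk, pulling back by a two-sheeted Blaschke map branched over that
point gives another cover, with a smaller derivative. -/
theorem comp_blaschkeSq (hp : IsHurwitzCover D w p W) {b : ℂ} (hb : ‖b‖ < 1)
    (hbW : -b ^ 2 ∉ W) :
    IsHurwitzCover D w (p ∘ blaschkeSq b)
      ((ball 0 1 ∩ blaschkeSq b ⁻¹' W) \ {diskShift (-b) (-b)}) := by
  have hb0 : b ≠ 0 := by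
    rintro rfl
    exact hbW (by simpa using hp.zero_mem)
  have hz' : diskShift (-b) (-b) ≠ 0 := by
    rw [diskShift]
    refine div_ne_zero ?_ (one_add_conj_mul_ne_zero (by rwa [norm_neg]) (by rwa [norm_neg]))
    rw [← two_mul]
    exact mul_ne_zero two_ne_zero (neg_ne_zero.2 hb0)
  have hzB : blaschkeSq b (diskShift (-b) (-b)) = 0 := by
    have h1 := diskShift_neg_self (-b ^ 2)
    rw [neg_neg] at h1
    rw [blaschkeSq, diskShift_diskShift_neg hb (by rwa [norm_neg]), neg_sq, h1]
  have hlift : ∀ h : ℂ → ℂ, ∀ z ∈ (ball 0 1 ∩ blaschkeSq b ⁻¹' W) \ {diskShift (-b) (-b)},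
      (∃ g : ℂ → ℂ, DifferentiableOn ℂ g (ball 0 1) ∧
        MapsTo g (ball 0 1) W ∧ g 0 = blaschkeSq b z ∧ (∀ t ∈ ball (0 : ℂ) 1, p (g t) = h t)) →
      (∀ t ∈ ball (0 : ℂ) 1, t ≠ 0 → h t ≠ w) →
      ∃ g : ℂ → ℂ, DifferentiableOn ℂ g (ball 0 1) ∧
        MapsTo g (ball 0 1) ((ball 0 1 ∩ blaschkeSq b ⁻¹' W) \ {diskShift (-b) (-b)}) ∧
        g 0 = z ∧ ∀ t ∈ ball (0 : ℂ) 1, (p ∘ blaschkeSq b) (g t) = h t := by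
    rintro h z ⟨⟨hz1, hzW⟩, hzne⟩ ⟨g, hg, hgm, hg0, hpg⟩ hne
    obtain ⟨k, hk, hkm, hk0, hkg⟩ := exists_blaschkeSq_lift hb hg (hgm.mono_right hp.subset)
      (fun t ht heq => hbW (heq ▸ hgm ht)) (by simpa using hz1) hg0.symm
    refine ⟨k, hk, fun t ht => ⟨⟨hkm ht, ?_⟩, fun heq => ?_⟩, hk0, fun t ht => ?_⟩
    · rw [mem_preimage, hkg t ht]
      exact hgm ht
    · rw [mem_singleton_iff] at heq
      by_cases ht0 : t = 0
      · rw [ht0, hk0] at heq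
        exact hzne heq
      · have h1 := hkg t ht
        rw [heq, hzB] at h1
        exact hne t ht ht0 (by rw [← hpg t ht, ← h1, hp.map_zero])
    · rw [Function.comp_apply, hkg t ht, hpg t ht]
  have hzero : (0 : ℂ) ∈ (ball 0 1 ∩ blaschkeSq b ⁻¹' W) \ {diskShift (-b) (-b)} :=
    ⟨⟨by simp, by rw [mem_preimage, blaschkeSq_zero]; exact hp.zero_mem⟩, hz'.symm⟩
  refine ⟨?_, fun z hz => hz.1.1, hzero, ?_, fun z hz => hp.mapsTo hz.1.2, ?_,
    fun z hz h => ?_, fun h hh => ?_, fun h hh hm z hz hpz => ?_⟩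
  · exact ((differentiableOn_blaschkeSq hb).continuousOn.isOpen_inter_preimage isOpen_ball
      hp.isOpen).sdiff isClosed_singleton
  · exact hp.differentiableOn.comp
      ((differentiableOn_blaschkeSq hb).mono fun z hz => hz.1.1) fun z hz => hz.1.2
  · rw [Function.comp_apply, blaschkeSq_zero, hp.map_zero]
  · exact (blaschkeSq_eq_zero hb (by simpa using hz.1.1) (hp.eq_zero _ hz.1.2 h)).resolve_right hz.2
  · exact hlift h 0 hzero (by rw [blaschkeSq_zero]; exact hp.lift_hurwitz h hh) hh.2.2.2
  · exact hlift h z hz (hp.lift_disk h hh hm _ hz.1.2 hpz) fun t ht _ => (hm ht).2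

theorem norm_deriv_comp_blaschkeSq (hp : IsHurwitzCover D w p W) {b : ℂ} (hb : ‖b‖ < 1) :
    ‖deriv (p ∘ blaschkeSq b) 0‖ = ‖deriv p 0‖ * (2 * ‖b‖ / (1 + ‖b‖ ^ 2)) := by
  rw [hp.deriv_eq_mul (h := p ∘ blaschkeSq b) (differentiableOn_blaschkeSq hb) (blaschkeSq_zero b)
    fun _ _ => rfl, norm_mul, norm_deriv_blaschkeSq hb]

end IsHurwitzCover

theorem two_mul_div_one_add_sq_le {x y : ℝ} (hx : 0 ≤ x) (hxy : x ≤ y) (hy : y ≤ 1) :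
    2 * x / (1 + x ^ 2) ≤ 2 * y / (1 + y ^ 2) := by
  rw [div_le_div_iff₀ (by positivity) (by positivity)]
  nlinarith [mul_nonneg (sub_nonneg.2 hxy) (show 0 ≤ 1 - x * y by nlinarith)]

theorem two_mul_div_one_add_sq_lt_one {x : ℝ} (hx : x < 1) : 2 * x / (1 + x ^ 2) < 1 := by
  rw [div_lt_one (by positivity)]
  nlinarith [sq_pos_of_pos (sub_pos.2 hx)]

theorem exists_neg_sq_eq (c : ℂ) : ∃ b : ℂ, -b ^ 2 = c ∧ ‖b‖ ^ 2 = ‖c‖ := by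
  obtain ⟨b, hb⟩ := IsAlgClosed.exists_pow_nat_eq (-c) two_pos
  exact ⟨b, by rw [hb, neg_neg], by rw [← norm_pow, hb, norm_neg]⟩

/-- The Hurwitz radius is the infimum of the derivatives of Hurwitz covers. -/
theorem exists_isHurwitzCover_norm_deriv_lt {D : Set ℂ} (hDo : IsOpen D) (hD : D ≠ univ) {w : ℂ}
    (hw : w ∈ D) (hex : ∃ p W, IsHurwitzCover D w p W) {m : ℝ} (hm : hurwitzRadius D w < m) :
    ∃ p W, IsHurwitzCover D w p W ∧ ‖deriv p 0‖ < m := by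
  by_contra! hcon
  have hr := hurwitzRadius_pos hDo hD hw
  set S : Set ℝ := {x | ∃ p W, IsHurwitzCover D w p W ∧ x = ‖deriv p 0‖} with hS
  have hSm : ∀ x ∈ S, m ≤ x := by
    rintro x ⟨p, W, hp, rfl⟩
    exact hcon p W hp
  have hSne : S.Nonempty := by
    obtain ⟨p, W, hp⟩ := hex
    exact ⟨_, p, W, hp, rfl⟩
  have hSb : BddBelow S := ⟨m, hSm⟩
  set μ := sInf S with hμ
  have hmμ : m ≤ μ := le_csInf hSne hSm
  have hμ0 : 0 < μ := by linarith
  obtain ⟨β, hβ1, hβ2⟩ : ∃ β < 1, Real.sqrt (hurwitzRadius D w / μ) < β := by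
    have : Real.sqrt (hurwitzRadius D w / μ) < 1 := by
      rw [Real.sqrt_lt' one_pos, one_pow, div_lt_one hμ0]
      linarith
    obtain ⟨β, h1, h2⟩ := exists_between this
    exact ⟨β, h2, h1⟩
  have hβ0 : 0 < β := (Real.sqrt_nonneg _).trans_lt hβ2
  have hβμ : hurwitzRadius D w < β ^ 2 * μ := by
    rwa [Real.sqrt_lt' hβ0, div_lt_iff₀ hμ0] at hβ2
  have hκ := two_mul_div_one_add_sq_lt_one hβ1
  have hκ0 : 0 < 2 * β / (1 + β ^ 2) := by positivity
  obtain ⟨_, ⟨p, W, hp, rfl⟩, hlt⟩ := exists_lt_of_csInf_lt hSne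
    (show sInf S < μ / (2 * β / (1 + β ^ 2)) by
      rw [← hμ, lt_div_iff₀ hκ0]
      exact mul_lt_of_lt_one_right hμ0 hκ)
  rw [lt_div_iff₀ hκ0] at hlt
  have hball : ball (0 : ℂ) (β ^ 2) ⊆ W := by
    intro c hc
    by_contra hcW
    obtain ⟨b, rfl, hbn⟩ := exists_neg_sq_eq c
    rw [mem_ball_zero_iff, ← hbn] at hc
    have hbβ : ‖b‖ < β := lt_of_pow_lt_pow_left₀ 2 hβ0.le hc
    have hb1 := hbβ.trans hβ1
    have h1 : μ ≤ _ := csInf_le hSb ⟨_, _, hp.comp_blaschkeSq hb1 hcW, rfl⟩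
    rw [hp.norm_deriv_comp_blaschkeSq hb1] at h1
    have h2 := mul_le_mul_of_nonneg_left
      (two_mul_div_one_add_sq_le (norm_nonneg b) hbβ.le hβ1.le) (norm_nonneg (deriv p 0))
    linarith
  have hβC : ‖((β ^ 2 : ℝ) : ℂ)‖ = β ^ 2 := by
    rw [Complex.norm_real, Real.norm_eq_abs, abs_of_nonneg (sq_nonneg β)]
  have hβC0 : ((β ^ 2 : ℝ) : ℂ) ≠ 0 := by exact_mod_cast (pow_pos hβ0 2).ne'
  have hmaps : MapsTo (fun z : ℂ => ((β ^ 2 : ℝ) : ℂ) * z) (ball 0 1) W := fun z hz => hball (by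
    rw [mem_ball_zero_iff] at hz ⊢
    rw [norm_mul, hβC]
    exact mul_lt_of_lt_one_right (pow_pos hβ0 2) hz)
  have hh : IsHurwitzMap D w (fun z => p (((β ^ 2 : ℝ) : ℂ) * z)) :=
    ⟨hp.differentiableOn.comp (differentiableOn_id.const_mul _) hmaps, hp.mapsTo.comp hmaps,
      by simp only [mul_zero, hp.map_zero], fun t ht ht0 h =>
        mul_ne_zero hβC0 ht0 (hp.eq_zero _ (hmaps ht) h)⟩
  have h1 := hh.norm_deriv_le_hurwitzRadius (exists_norm_deriv_hurwitzMap_le hD hw)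
  rw [hp.deriv_eq_mul (g := fun z => ((β ^ 2 : ℝ) : ℂ) * z) (by fun_prop) (by simp)
    (fun _ _ => rfl), norm_mul] at h1
  have h2 : deriv (fun z : ℂ => ((β ^ 2 : ℝ) : ℂ) * z) 0 = ((β ^ 2 : ℝ) : ℂ) := by
    rw [deriv_const_mul_field, deriv_id'', mul_one]
  rw [h2, hβC] at h1
  have h3 : μ ≤ ‖deriv p 0‖ := csInf_le hSb ⟨p, W, hp, rfl⟩
  nlinarith [pow_pos hβ0 2]

/-- The points of a domain lie uniformly inside the images of the Hurwitz covers of its bounded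
parts. -/
theorem exists_norm_le_of_isHurwitzCover {Y : Set ℂ} (hYo : IsOpen Y) (hYc : IsPreconnected Y)
    {w : ℂ} (hw : w ∈ Y) {a : ℂ} (ha : a ∈ Y) :
    ∃ ρ < 1, ∃ R₀ : ℝ, ∀ R ≥ R₀, ∀ p W, IsHurwitzCover (Y ∩ ball w R) w p W →
      ∃ c ∈ W, ‖c‖ ≤ ρ ∧ p c = a := by
  set A : Set ℂ := {a | ∃ ρ < 1, ∃ R₀ : ℝ, ∀ R ≥ R₀, ∀ p W, IsHurwitzCover (Y ∩ ball w R) w p W →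
      ∃ c ∈ W, ‖c‖ ≤ ρ ∧ p c = a} with hA
  have hwA : w ∈ A := ⟨0, one_pos, 0, fun R _ p W hp => ⟨0, hp.zero_mem, by simp, hp.map_zero⟩⟩
  have hscale : ∀ {s : ℝ}, 0 < s → ∀ {a x : ℂ}, x ∈ ball a s →
      (x - a) / s ∈ ball (0 : ℂ) 1 ∧ a + s * ((x - a) / s) = x := by
    intro s hs a x hx
    have hsC : (s : ℂ) ≠ 0 := by exact_mod_cast hs.ne'
    refine ⟨?_, by field_simp; ring⟩
    rw [mem_ball, dist_eq_norm] at hx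
    rw [mem_ball_zero_iff, norm_div, Complex.norm_real, Real.norm_eq_abs, abs_of_pos hs]
    exact (div_lt_one hs).2 hx
  have hnear : ∀ s : ℝ, 0 < s → ball w s ⊆ Y → ball w s ⊆ A := by
    intro s hs hsY x hx
    obtain ⟨ht, hxt⟩ := hscale hs hx
    refine ⟨‖(x - w) / s‖, by simpa using ht, s, fun R hR p W hp => ?_⟩
    obtain ⟨g, hg, hgm, hg0, hpg⟩ := hp.lift_hurwitz _ (isHurwitzMap_affine hs
      (subset_inter hsY (ball_subset_ball hR))).1
    refine ⟨g ((x - w) / s), hgm ht, ?_, by rw [hpg _ ht, hxt]⟩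
    exact norm_le_norm_of_mapsTo_ball hg
      (hgm.mono_right (hp.subset.trans ball_subset_closedBall)) hg0 (by simpa using ht)
  have hfar : ∀ a ∈ A, ∀ s : ℝ, 0 < s → ball a s ⊆ Y \ {w} → ball a s ⊆ A := by
    rintro a ⟨ρ, hρ1, R₀, hR₀⟩ s hs hsY x hx
    obtain ⟨ht, hxt⟩ := hscale hs hx
    set t := (x - a) / s with ht_def
    have hτ : ‖t‖ < 1 := by simpa using ht
    refine ⟨Real.sqrt (1 - (1 - (max ρ 0) ^ 2) * (1 - ‖t‖ ^ 2) / 4), ?_, max R₀ (dist a w + s),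
      fun R hR p W hp => ?_⟩
    · rw [Real.sqrt_lt' one_pos]
      have h1 : 0 < 1 - (max ρ 0) ^ 2 :=
        sub_pos.2 (pow_lt_one₀ (le_max_right _ _) (max_lt hρ1 one_pos) two_ne_zero)
      have h2 : 0 < 1 - ‖t‖ ^ 2 := sub_pos.2 (pow_lt_one₀ (norm_nonneg _) hτ two_ne_zero)
      nlinarith [mul_pos h1 h2]
    · obtain ⟨c, hcW, hcρ, hpc⟩ := hR₀ R ((le_max_left _ _).trans hR) p W hp
      have haff := isHurwitzMap_affine hs (Subset.rfl : ball a s ⊆ ball a s)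
      have hsub : ball a s ⊆ ball w R :=
        ball_subset_ball' (by linarith [(le_max_right R₀ (dist a w + s)).trans hR])
      obtain ⟨g, hg, hgm, hg0, hpg⟩ := hp.lift_disk _ haff.1.1
        (haff.1.2.1.mono_right fun y hy => ⟨⟨(hsY hy).1, hsub hy⟩, (hsY hy).2⟩) c hcW
        (by simp [hpc])
      refine ⟨g t, hgm ht, ?_, by rw [hpg t ht, hxt]⟩
      have hgm1 := hgm.mono_right hp.subset
      have hc1 : ‖c‖ < 1 := by simpa using hp.subset hcW
      have hc1' : ‖-c‖ < 1 := by rwa [norm_neg]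
      have hgt : ‖g t‖ < 1 := by simpa using hgm1 ht
      have h1 : ‖diskShift (-c) (g t)‖ ≤ ‖t‖ := by
        refine norm_le_norm_of_mapsTo_ball (f := fun t => diskShift (-c) (g t)) (R := 1)
          ((differentiableOn_diskShift hc1').comp hg hgm1)
          (((mapsTo_diskShift hc1').comp hgm1).mono_right ball_subset_closedBall) ?_ hτ
        have := diskShift_neg_self (-c)
        rw [neg_neg] at this
        simp only [hg0, this]
      have h2 := sq_norm_diskShift_le (hcρ.trans (le_max_left ρ 0)) (max_lt hρ1 one_pos) h1 hτ
      rw [diskShift_diskShift_neg hc1 hgt] at h2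
      exact Real.le_sqrt_of_sq_le h2
  have hlocal : ∀ x ∈ Y, ∃ s > 0, ball x s ⊆ Y ∧ (x = w ∨ ball x s ⊆ Y \ {w}) := by
    intro x hx
    by_cases hxw : x = w
    · obtain ⟨s, hs, hsY⟩ := Metric.isOpen_iff.1 hYo x hx
      exact ⟨s, hs, hsY, Or.inl hxw⟩
    · obtain ⟨s, hs, hsY⟩ := Metric.isOpen_iff.1 (hYo.sdiff isClosed_singleton) x ⟨hx, hxw⟩
      exact ⟨s, hs, hsY.trans sdiff_subset, Or.inr hsY⟩
  have hAint : ∀ x ∈ Y, x ∈ A → x ∈ interior A := by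
    intro x hx hxA
    obtain ⟨s, hs, hsY, hsw⟩ := hlocal x hx
    refine mem_interior.2 ⟨ball x s, ?_, isOpen_ball, mem_ball_self hs⟩
    rcases hsw with rfl | hsw
    · exact hnear s hs hsY
    · exact hfar x hxA s hs hsw
  suffices hYA : Y ⊆ interior A from interior_subset (s := A) (hYA ha)
  refine hYc.subset_of_closure_inter_subset isOpen_interior ⟨w, hw, hAint w hw hwA⟩ ?_
  rintro x ⟨hxc, hxY⟩
  obtain ⟨s, hs, hsY, hsw⟩ := hlocal x hxY
  refine hAint x hxY ?_
  rcases hsw with rfl | hsw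
  · exact hwA
  · obtain ⟨y, hyA, hxy⟩ := Metric.mem_closure_iff.1 hxc (s / 2) (half_pos hs)
    have hsub : ball y (s / 2) ⊆ ball x s := ball_subset_ball' (by
      rw [dist_comm] at hxy; linarith)
    exact hfar y (interior_subset hyA) (s / 2) (half_pos hs) (hsub.trans hsw) hxy

theorem hurwitzRadius_lt {Y Ω : Set ℂ} (hYo : IsOpen Y) (hYc : IsPreconnected Y)
    (hYu : Y ≠ univ) (hsub : Ω ⊆ Y) (hne : Ω ≠ Y) {w : ℂ} (hw : w ∈ Ω) :
    hurwitzRadius Ω w < hurwitzRadius Y w := by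
  obtain ⟨a, haY, haΩ⟩ := Set.exists_of_ssubset (hsub.ssubset_of_ne hne)
  have hwY := hsub hw
  obtain ⟨ρ, hρ1, R₀, hR₀⟩ := exists_norm_le_of_isHurwitzCover hYo hYc hwY haY
  have hrY := hurwitzRadius_pos hYo hYu hwY
  set β := Real.sqrt (max ρ 0) with hβ
  have hβ1 : β < 1 := by
    rw [hβ, Real.sqrt_lt' one_pos, one_pow]
    exact max_lt hρ1 one_pos
  set κ := 2 * β / (1 + β ^ 2) with hκ
  have hκ1 : κ < 1 := two_mul_div_one_add_sq_lt_one hβ1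
  have hκ0 : 0 ≤ κ := by have := Real.sqrt_nonneg (max ρ 0); positivity
  refine (hurwitzRadius_le (C := hurwitzRadius Y w * κ) (by positivity) fun h hh => ?_).trans_lt
    (mul_lt_of_lt_one_right hrY hκ1)
  have hshrink : ∀ s : ℝ, 0 < s → s < 1 → s * ‖deriv h 0‖ ≤ hurwitzRadius Y w * κ := by
    intro s hs0 hs1
    have hsn : ‖(s : ℂ)‖ = s := by rw [Complex.norm_real, Real.norm_eq_abs, abs_of_pos hs0]
    have hsC : (s : ℂ) ≠ 0 := by exact_mod_cast hs0.ne'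
    obtain ⟨hk, hkd⟩ := hh.comp_mul (hsn.trans_le hs1.le) hsC
    set k : ℂ → ℂ := fun z => h (s * z) with hkdef
    obtain ⟨B, hB⟩ := ((isCompact_closedBall (0 : ℂ) s).image_of_continuousOn
      (hh.1.continuousOn.mono (closedBall_subset_ball hs1))).isBounded.subset_ball w
    set R := max (max R₀ B) 1 with hR
    have hkB : MapsTo k (ball 0 1) (ball w R) := fun z hz =>
      ball_subset_ball ((le_max_right R₀ B).trans (le_max_left _ _)) (hB ⟨s * z, by
        rw [mem_ball_zero_iff] at hz
        rw [mem_closedBall_zero_iff, norm_mul, hsn]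
        exact mul_le_of_le_one_right hs0.le hz.le, rfl⟩)
    have hwD : w ∈ Y ∩ ball w R := ⟨hwY, mem_ball_self (one_pos.trans_le (le_max_right _ _))⟩
    have hkD : IsHurwitzMap (Y ∩ ball w R) w k :=
      ⟨hk.1, fun z hz => ⟨hsub (hk.2.1 hz), hkB hz⟩, hk.2.2⟩
    have hDo : IsOpen (Y ∩ ball w R) := hYo.inter isOpen_ball
    have hDu : Y ∩ ball w R ≠ univ := fun h => hYu (eq_univ_of_univ_subset (h ▸ inter_subset_left))
    have hle : ∀ p W, IsHurwitzCover (Y ∩ ball w R) w p W →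
        s * ‖deriv h 0‖ ≤ ‖deriv p 0‖ * κ := by
      intro p W hp
      obtain ⟨c, hcW, hcρ, hpc⟩ := hR₀ R ((le_max_left R₀ B).trans (le_max_left _ _)) p W hp
      obtain ⟨b, hbc, hbn⟩ := exists_neg_sq_eq c
      have hbβ : ‖b‖ ≤ β := Real.le_sqrt_of_sq_le (by
        rw [hbn]; exact hcρ.trans (le_max_left _ _))
      obtain ⟨g, hg, hgm, hg0, hpg⟩ := hp.lift_hurwitz k hkD
      have h1 := norm_deriv_le_of_omits (hbβ.trans_lt hβ1) hg (hgm.mono_right hp.subset)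
        (fun t ht heq => haΩ (by
          rw [← hpc, ← hbc, ← heq, hpg t ht]
          exact hk.2.1 ht)) hg0
      have h2 := h1.trans (two_mul_div_one_add_sq_le (norm_nonneg b) hbβ hβ1.le)
      rw [hp.deriv_eq_mul hg hg0 hpg] at hkd
      have h3 : s * ‖deriv h 0‖ = ‖deriv p 0‖ * ‖deriv g 0‖ := by
        rw [← norm_mul, hkd, norm_mul, hsn]
      rw [h3]
      gcongr
    have hD := hurwitzRadius_mono (inter_subset_left : Y ∩ ball w R ⊆ Y) hYu hwY
    have hex : ∃ p W, IsHurwitzCover (Y ∩ ball w R) w p W :=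
      ⟨_, _, isHurwitzCover_affine hDo hwD (one_pos.trans_le (le_max_right _ _))
        inter_subset_right⟩
    refine le_of_forall_pos_le_add fun ε hε => ?_
    obtain ⟨p, W, hp, hlt⟩ := exists_isHurwitzCover_norm_deriv_lt hDo hDu hwD hex
      (lt_add_of_pos_right (hurwitzRadius (Y ∩ ball w R) w) hε)
    have h1 := hle p W hp
    nlinarith
  have hlim : Tendsto (fun s : ℝ => s * ‖deriv h 0‖) (𝓝[<] 1) (𝓝 (1 * ‖deriv h 0‖)) :=
    ((continuous_id.mul continuous_const).tendsto 1).mono_left nhdsWithin_le_nhds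
  rw [one_mul] at hlim
  refine le_of_tendsto hlim ?_
  filter_upwards [Ioo_mem_nhdsLT (zero_lt_one' ℝ)] with s hs using hshrink s hs.1 hs.2

/-! ### Contraction constants -/

/-- The Hurwitz radius is lower semicontinuous. -/
theorem isOpen_lt_hurwitzRadius {D : Set ℂ} (hDo : IsOpen D) (hD : D ≠ univ) (c : ℝ) :
    IsOpen {w | w ∈ D ∧ c < hurwitzRadius D w} := by
  rw [Metric.isOpen_iff]
  rintro w ⟨hw, hc⟩
  obtain ⟨h, hh, hch⟩ : ∃ h, IsHurwitzMap D w h ∧ c < ‖deriv h 0‖ := by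
    by_contra! hcon
    obtain ⟨s, hs, hsD⟩ := Metric.isOpen_iff.1 hDo w hw
    have hc0 := (norm_nonneg _).trans (hcon _ (isHurwitzMap_affine hs hsD).1)
    exact hc.not_ge (hurwitzRadius_le hc0 hcon)
  have hlim : Tendsto (fun s : ℝ => s * ‖deriv h 0‖) (𝓝[<] 1) (𝓝 (1 * ‖deriv h 0‖)) :=
    ((continuous_id.mul continuous_const).tendsto 1).mono_left nhdsWithin_le_nhds
  rw [one_mul] at hlim
  obtain ⟨s, hcs, hs0, hs1⟩ :=
    ((hlim.eventually (lt_mem_nhds hch)).and (Ioo_mem_nhdsLT one_pos)).exists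
  have hsn : ‖(s : ℂ)‖ = s := by rw [Complex.norm_real, Real.norm_eq_abs, abs_of_pos hs0]
  have hsC : (s : ℂ) ≠ 0 := by exact_mod_cast hs0.ne'
  obtain ⟨hk, hkd⟩ := hh.comp_mul (hsn.trans_le hs1.le) hsC
  set k : ℂ → ℂ := fun z => h (s * z) with hkdef
  obtain ⟨δ, hδ, hthick⟩ := ((isCompact_closedBall (0 : ℂ) s).image_of_continuousOn
    (hh.1.continuousOn.mono (closedBall_subset_ball hs1))).exists_thickening_subset_open hDo
      (image_subset_iff.2 fun z hz => hh.2.1 (closedBall_subset_ball hs1 hz))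
  have hkt : ∀ z ∈ ball (0 : ℂ) 1, ball (k z) δ ⊆ D := fun z hz =>
    (ball_subset_thickening (mem_image_of_mem h (x := (s : ℂ) * z) <| by
      rw [mem_ball_zero_iff] at hz
      rw [mem_closedBall_zero_iff, norm_mul, hsn]
      exact mul_le_of_le_one_right hs0.le hz.le) δ).trans hthick
  have hk0 : k 0 = w := hk.2.2.1
  refine ⟨δ, hδ, fun x hx => ?_⟩
  have hxD : x ∈ D := hkt 0 (mem_ball_self one_pos) (hk0.symm ▸ hx)
  have hkx : IsHurwitzMap D x (fun z => k z + (x - w)) := by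
    refine ⟨hk.1.add_const _, fun z hz => hkt z hz ?_, by simp only [hk0, add_sub_cancel],
      fun t ht ht0 heq => hk.2.2.2 t ht ht0 (by linear_combination heq)⟩
    rw [mem_ball, dist_eq_norm] at hx ⊢
    rwa [add_sub_cancel_left]
  have h1 := hkx.norm_deriv_le_hurwitzRadius (exists_norm_deriv_hurwitzMap_le hD hxD)
  rw [deriv_add_const, hkd, norm_mul, hsn] at h1
  exact ⟨hxD, hcs.trans_le h1⟩

theorem hurwitzDensity_nonneg (D : Set ℂ) (w : ℂ) : 0 ≤ hurwitzDensity D w :=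
  div_nonneg zero_le_two (hurwitzRadius_nonneg D w)

theorem hurwitzDensity_le_of_ball_subset {D : Set ℂ} (hD : D ≠ univ) {w : ℂ} {s : ℝ} (hs : 0 < s)
    (hsD : ball w s ⊆ D) : hurwitzDensity D w ≤ 2 / s := by
  obtain ⟨hh, hd⟩ := isHurwitzMap_affine hs hsD
  have h1 := hh.norm_deriv_le_hurwitzRadius
    (exists_norm_deriv_hurwitzMap_le hD (hsD (mem_ball_self hs)))
  rw [hd, Complex.norm_real, Real.norm_eq_abs, abs_of_pos hs] at h1
  exact div_le_div_of_nonneg_left zero_le_two hs h1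

theorem aemeasurable_hurwitzDensity_comp {D : Set ℂ} (hDo : IsOpen D) (hD : D ≠ univ)
    {γ : ℝ → ℂ} {s : Set ℝ} (hs : MeasurableSet s) (hγ : ContinuousOn γ s) (hm : MapsTo γ s D) :
    AEMeasurable (fun t => hurwitzDensity D (γ t)) (MeasureTheory.volume.restrict s) := by
  refine (aemeasurable_restrict_of_measurable_subtype hs (measurable_of_Ioi fun c => ?_)).const_div 2
  have : (fun t : s => hurwitzRadius D (γ t)) ⁻¹' Ioi c =
      (fun t : s => γ t) ⁻¹' {w | w ∈ D ∧ c < hurwitzRadius D w} := by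
    ext t
    exact ⟨fun h => ⟨hm t.2, h⟩, fun h => h.2⟩
  rw [this]
  exact ((isOpen_lt_hurwitzRadius hDo hD c).preimage hγ.domRestrict).measurableSet

theorem IsPathIn.intervalIntegrable {D : Set ℂ} (hDo : IsOpen D) (hD : D ≠ univ) {w₁ w₂ : ℂ}
    {γ : ℝ → ℂ} (hγ : IsPathIn D w₁ w₂ γ) :
    IntervalIntegrable (fun t => hurwitzDensity D (γ t) * ‖derivWithin γ (Icc (0 : ℝ) 1) t‖)
      MeasureTheory.volume 0 1 := by
  obtain ⟨-, -, hm, hd⟩ := hγ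
  have hdc := (hd.continuousOn_derivWithin (uniqueDiffOn_Icc zero_lt_one) le_rfl).norm
  obtain ⟨δ, hδ, hthick⟩ :=
    (isCompact_Icc.image_of_continuousOn hd.continuousOn).exists_thickening_subset_open hDo
      (image_subset_iff.2 hm)
  rw [intervalIntegrable_iff_integrableOn_Icc_of_le zero_le_one]
  refine (hdc.integrableOn_compact isCompact_Icc).bdd_mul (c := 2 / δ)
    (aemeasurable_hurwitzDensity_comp hDo hD measurableSet_Icc
      hd.continuousOn hm).aestronglyMeasurable ?_
  refine MeasureTheory.ae_restrict_of_forall_mem measurableSet_Icc fun t ht => ?_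
  rw [Real.norm_of_nonneg (hurwitzDensity_nonneg D _)]
  exact hurwitzDensity_le_of_ball_subset hD hδ
    ((ball_subset_thickening (mem_image_of_mem γ ht) δ).trans hthick)

theorem hurwitzDensity_div_le_one {Y Ω : Set ℂ} (hΩ : IsOpen Ω) (hY : Y ≠ univ) (hsub : Ω ⊆ Y)
    {w : ℂ} (hw : w ∈ Ω) : hurwitzDensity Y w / hurwitzDensity Ω w ≤ 1 := by
  have hΩu : Ω ≠ univ := fun h => hY (univ_subset_iff.1 (h ▸ hsub))
  have hr := hurwitzRadius_pos hΩ hΩu hw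
  exact div_le_one_of_le₀ (div_le_div_of_nonneg_left zero_le_two hr
    (hurwitzRadius_mono hsub hY (hsub hw))) (hurwitzDensity_nonneg Ω w)

theorem lEta_nonneg (Ω Y : Set ℂ) : 0 ≤ lEta Ω Y := Real.sSup_nonneg <| by
  rintro _ ⟨w, -, rfl⟩
  exact div_nonneg (hurwitzDensity_nonneg Y w) (hurwitzDensity_nonneg Ω w)

theorem hurwitzDensity_le_lEta_mul {Y Ω : Set ℂ} (hΩ : IsOpen Ω) (hY : Y ≠ univ) (hsub : Ω ⊆ Y)
    {w : ℂ} (hw : w ∈ Ω) : hurwitzDensity Y w ≤ lEta Ω Y * hurwitzDensity Ω w := by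
  have hΩu : Ω ≠ univ := fun h => hY (univ_subset_iff.1 (h ▸ hsub))
  have hpos : 0 < hurwitzDensity Ω w := div_pos two_pos (hurwitzRadius_pos hΩ hΩu hw)
  rw [← div_le_iff₀ hpos]
  refine le_csSup ⟨1, ?_⟩ ⟨w, hw, rfl⟩
  rintro _ ⟨x, hx, rfl⟩
  exact hurwitzDensity_div_le_one hΩ hY hsub hx

theorem hurwitzDist_nonneg (D : Set ℂ) (w₁ w₂ : ℂ) : 0 ≤ hurwitzDist D w₁ w₂ :=
  Real.sInf_nonneg <| by
    rintro _ ⟨γ, -, rfl⟩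
    exact intervalIntegral.integral_nonneg zero_le_one fun t _ =>
      mul_nonneg (hurwitzDensity_nonneg D _) (norm_nonneg _)

theorem hurwitzDist_div_le_lEta {Y Ω : Set ℂ} (hYo : IsOpen Y) (hΩ : IsOpen Ω) (hY : Y ≠ univ)
    (hsub : Ω ⊆ Y) (w₁ w₂ : ℂ) : hurwitzDist Y w₁ w₂ / hurwitzDist Ω w₁ w₂ ≤ lEta Ω Y := by
  have hΩu : Ω ≠ univ := fun h => hY (univ_subset_iff.1 (h ▸ hsub))
  have hle : ∀ γ, IsPathIn Ω w₁ w₂ γ → hurwitzDist Y w₁ w₂ ≤ lEta Ω Y *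
      ∫ t in (0 : ℝ)..1, hurwitzDensity Ω (γ t) * ‖derivWithin γ (Icc (0 : ℝ) 1) t‖ := by
    intro γ hγ
    have hγY : IsPathIn Y w₁ w₂ γ := ⟨hγ.1, hγ.2.1, fun t ht => hsub (hγ.2.2.1 t ht), hγ.2.2.2⟩
    calc hurwitzDist Y w₁ w₂
        ≤ ∫ t in (0 : ℝ)..1, hurwitzDensity Y (γ t) * ‖derivWithin γ (Icc (0 : ℝ) 1) t‖ := by
          refine csInf_le ⟨0, ?_⟩ ⟨γ, hγY, rfl⟩
          rintro _ ⟨σ, -, rfl⟩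
          exact intervalIntegral.integral_nonneg zero_le_one fun t _ =>
            mul_nonneg (hurwitzDensity_nonneg Y _) (norm_nonneg _)
      _ ≤ ∫ t in (0 : ℝ)..1, lEta Ω Y *
            (hurwitzDensity Ω (γ t) * ‖derivWithin γ (Icc (0 : ℝ) 1) t‖) := by
          refine intervalIntegral.integral_mono_on zero_le_one (hγY.intervalIntegrable hYo hY)
            ((hγ.intervalIntegrable hΩ hΩu).const_mul _) fun t ht => ?_
          rw [← mul_assoc]
          exact mul_le_mul_of_nonneg_right
            (hurwitzDensity_le_lEta_mul hΩ hY hsub (hγ.2.2.1 t ht)) (norm_nonneg _)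
      _ = _ := intervalIntegral.integral_const_mul _ _
  rcases (hurwitzDist_nonneg Ω w₁ w₂).eq_or_lt with h0 | h0
  · rw [← h0, div_zero]
    exact lEta_nonneg Ω Y
  have hne : {L : ℝ | ∃ γ : ℝ → ℂ, IsPathIn Ω w₁ w₂ γ ∧ L = ∫ t in (0 : ℝ)..1,
      hurwitzDensity Ω (γ t) * ‖derivWithin γ (Icc (0 : ℝ) 1) t‖}.Nonempty := by
    rw [nonempty_iff_ne_empty]
    intro h
    rw [hurwitzDist, h, Real.sInf_empty] at h0
    exact h0.false
  rw [div_le_iff₀ h0]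
  rcases (lEta_nonneg Ω Y).eq_or_lt with hl | hl
  · obtain ⟨_, γ, hγ, rfl⟩ := hne
    simpa [← hl] using hle γ hγ
  · rw [← div_le_iff₀' hl]
    refine le_csInf hne ?_
    rintro _ ⟨γ, hγ, rfl⟩
    exact (div_le_iff₀' hl).2 (hle γ hγ)

end

/-- `gl_η(Ω,Y) ≤ l_η(Ω,Y) ≤ 1`, and the inclusion is a strict
infinitesimal contraction when `Ω ⊊ Y`. -/
theorem hurwitz_contraction_constants
    (Y Ω : Set ℂ) (hY : IsPlaneDomain Y) (hYp : Y ≠ Set.univ)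
    (hΩ : IsPlaneDomain Ω) (hsub : Ω ⊆ Y) :
    glEta Ω Y ≤ lEta Ω Y ∧ lEta Ω Y ≤ 1 ∧
    (Ω ≠ Y → ∀ w ∈ Ω, hurwitzDensity Y w < hurwitzDensity Ω w) := by
  have hΩu : Ω ≠ univ := fun h => hYp (univ_subset_iff.1 (h ▸ hsub))
  refine ⟨Real.sSup_le ?_ (lEta_nonneg Ω Y), Real.sSup_le ?_ zero_le_one, fun hne w hw => ?_⟩
  · rintro _ ⟨w₁, -, w₂, -, -, rfl⟩
    exact hurwitzDist_div_le_lEta hY.1 hΩ.1 hYp hsub w₁ w₂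
  · rintro _ ⟨w, hw, rfl⟩
    exact hurwitzDensity_div_le_one hΩ.1 hYp hsub hw
  · exact div_lt_div_of_pos_left two_pos (hurwitzRadius_pos hΩ.1 hΩu hw)
      (hurwitzRadius_lt hY.1 hY.2.isPreconnected hYp hsub hne hw)
end
end
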